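/- arXiv:2308.11118 — 2 statements merged into one kernel-verified Lean document; each statement's English description precedes it below -/
import Mathlib

section
/- For every integer m ≥ 1 and every integer h ≥ 2, the counting function b_{m,h}(t) is a quasipolynomial in t of degree m−1 with leading coefficient 1/(m−1)!. -/
/-- A ruler of length `t` with `m+1` markings: `0 = x 0 < x 1 < ⋯ < x m = t`. -/
def IsRuler (m : ℕ) (t : ℤ) (x : Fin (m + 1) → ℤ) : Prop :=
  StrictMono x ∧ x 0 = 0 ∧ x (Fin.last m) = t

/-- A ruler is a `B_h`-set if any two distinct multisets of `h` markings have distinct sums. -/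
def IsBhSet (m h : ℕ) (x : Fin (m + 1) → ℤ) : Prop :=
  ∀ r s : Multiset (Fin (m + 1)), Multiset.card r = h → Multiset.card s = h → r ≠ s →
    (r.map x).sum ≠ (s.map x).sum

/-- `b_{m,h}(t)`: the number of `B_h`-sets of length `t` with `m+1` markings. -/
noncomputable def bmh (m h : ℕ) (t : ℤ) : ℕ :=
  Nat.card {x : Fin (m + 1) → ℤ // IsRuler m t x ∧ IsBhSet m h x}

section PiecewiseQuasipolynomials

theorem adjoin_subset_span {R A : Type*} [CommSemiring R] [CommSemiring A] [Algebra R A]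
    {G S : Set A} (h_one : 1 ∈ Submodule.span R S)
    (h_mul : ∀ a ∈ S, ∀ b ∈ S, a * b ∈ Submodule.span R S) (hG : G ⊆ Submodule.span R S)
    {f : A} (hf : f ∈ Algebra.adjoin R G) : f ∈ Submodule.span R S := by
  have h : Submodule.span R S * Submodule.span R S ≤ Submodule.span R S := by
    rw [Submodule.span_mul_span, Submodule.span_le]
    rintro _ ⟨a, ha, b, hb, rfl⟩
    exact h_mul a ha b hb
  exact Algebra.adjoin_le (S := (Submodule.span R S).toSubalgebra h_one
    fun a b ha hb => h (Submodule.mul_mem_mul ha hb)) hG hf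

/-- The forward difference in the last coordinate. -/
def lastDiff (M : Type*) : (M × ℤ → ℚ) →ₗ[ℚ] (M × ℤ → ℚ) where
  toFun G z := G (z.1, z.2 + 1) - G z
  map_add' F G := by ext z; simp only [Pi.add_apply]; ring
  map_smul' c G := by ext z; simp only [Pi.smul_apply, smul_eq_mul, RingHom.id_apply]; ring

theorem lastDiff_apply (G : M × ℤ → ℚ) (z : M × ℤ) :
    lastDiff M G z = G (z.1, z.2 + 1) - G z := rfl

theorem sum_range_mul_sub (f : ℕ → ℚ) (n : ℕ) :
    ∑ j ∈ Finset.range n, (j : ℚ) * (f (j + 1) - f j) + ∑ j ∈ Finset.range n, f (j + 1) =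
      n * f n := by
  induction n with
  | zero => simp
  | succ n ih =>
    rw [Finset.sum_range_succ, Finset.sum_range_succ]
    push_cast
    linear_combination ih

variable {M N : Type*} [AddCommGroup M] [AddCommGroup N]

/-- A function on an abelian group invariant under translation by `s • M` for some `s > 0`. -/
def IsModPeriodic (g : M → ℚ) : Prop :=
  ∃ s : ℕ, 0 < s ∧ ∀ x z : M, g (x + s • z) = g x

/-- The algebra of quasipolynomials on `M`, generated by integral linear forms and periodic
functions. -/
def quasiPoly (M : Type*) [AddCommGroup M] : Subalgebra ℚ (M → ℚ) :=
  Algebra.adjoin ℚ {g | (∃ φ : M →+ ℤ, g = fun x => (φ x : ℚ)) ∨ IsModPeriodic g}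

/-- The indicator function of the open half-space `0 < φ`. -/
def posInd (φ : M →+ ℤ) (x : M) : ℚ := if 0 < φ x then 1 else 0

/-- The algebra of piecewise quasipolynomials on `M`, whose pieces are cut out by homogeneous
linear inequalities. -/
def pwQuasiPoly (M : Type*) [AddCommGroup M] : Subalgebra ℚ (M → ℚ) :=
  Algebra.adjoin ℚ ((quasiPoly M : Set (M → ℚ)) ∪ Set.range posInd)

theorem IsModPeriodic.const (c : ℚ) : IsModPeriodic (fun _ : M => c) :=
  ⟨1, one_pos, fun _ _ => rfl⟩

theorem IsModPeriodic.map₂ {f g : M → ℚ} (hf : IsModPeriodic f) (hg : IsModPeriodic g)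
    (op : ℚ → ℚ → ℚ) : IsModPeriodic (fun x => op (f x) (g x)) := by
  obtain ⟨s, hs, hf⟩ := hf
  obtain ⟨t, ht, hg⟩ := hg
  refine ⟨s * t, Nat.mul_pos hs ht, fun x z => ?_⟩
  simp only
  congr 1
  · rw [mul_smul, hf]
  · rw [mul_comm, mul_smul, hg]

theorem IsModPeriodic.comp {f : M → ℚ} (hf : IsModPeriodic f) (T : N →+ M) :
    IsModPeriodic (fun x => f (T x)) := by
  obtain ⟨s, hs, hf⟩ := hf
  exact ⟨s, hs, fun x z => by simp only [map_add, map_nsmul, hf]⟩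

theorem IsModPeriodic.translate {f : M → ℚ} (hf : IsModPeriodic f) (v : M) :
    IsModPeriodic (fun x => f (x + v)) := by
  obtain ⟨s, hs, hf⟩ := hf
  exact ⟨s, hs, fun x z => by simp only [add_right_comm, hf]⟩

theorem IsModPeriodic.sum {ι : Type*} (s : Finset ι) {f : ι → M → ℚ}
    (hf : ∀ i ∈ s, IsModPeriodic (f i)) : IsModPeriodic (fun x => ∑ i ∈ s, f i x) := by
  classical
  induction s using Finset.induction_on with
  | empty => simpa using IsModPeriodic.const (M := M) 0
  | insert a s ha ih =>
    simp only [Finset.sum_insert ha]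
    exact (hf a (by simp)).map₂ (ih fun i hi => hf i (by simp [hi])) (· + ·)

theorem linear_mem_quasiPoly (φ : M →+ ℤ) : (fun x => (φ x : ℚ)) ∈ quasiPoly M :=
  Algebra.subset_adjoin (Or.inl ⟨φ, rfl⟩)

theorem IsModPeriodic.mem_quasiPoly {g : M → ℚ} (hg : IsModPeriodic g) : g ∈ quasiPoly M :=
  Algebra.subset_adjoin (Or.inr hg)

theorem mem_pwQuasiPoly_of_mem_quasiPoly {g : M → ℚ} (hg : g ∈ quasiPoly M) :
    g ∈ pwQuasiPoly M :=
  Algebra.subset_adjoin (Or.inl hg)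

theorem posInd_mem_pwQuasiPoly (φ : M →+ ℤ) : posInd φ ∈ pwQuasiPoly M :=
  Algebra.subset_adjoin (Or.inr ⟨φ, rfl⟩)

theorem quasiPoly_comp {f : M → ℚ} (hf : f ∈ quasiPoly M) (T : N →+ M) :
    (fun x => f (T x)) ∈ quasiPoly N := by
  induction hf using Algebra.adjoin_induction with
  | mem g hg =>
    obtain ⟨φ, rfl⟩ | hg := hg
    · exact linear_mem_quasiPoly (φ.comp T)
    · exact (hg.comp T).mem_quasiPoly
  | algebraMap c => exact (quasiPoly N).algebraMap_mem c
  | add f g _ _ hf hg => exact add_mem hf hg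
  | mul f g _ _ hf hg => exact mul_mem hf hg

theorem pwQuasiPoly_comp {f : M → ℚ} (hf : f ∈ pwQuasiPoly M) (T : N →+ M) :
    (fun x => f (T x)) ∈ pwQuasiPoly N := by
  induction hf using Algebra.adjoin_induction with
  | mem g hg =>
    obtain hg | ⟨φ, rfl⟩ := hg
    · exact mem_pwQuasiPoly_of_mem_quasiPoly (quasiPoly_comp hg T)
    · exact posInd_mem_pwQuasiPoly (φ.comp T)
  | algebraMap c => exact (pwQuasiPoly N).algebraMap_mem c
  | add f g _ _ hf hg => exact add_mem hf hg
  | mul f g _ _ hf hg => exact mul_mem hf hg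

/-- A periodic function is the sum of a periodic difference and a periodic function that does not
depend on the last coordinate. -/
theorem IsModPeriodic.exists_lastDiff {p : M × ℤ → ℚ} (hp : IsModPeriodic p) :
    ∃ q r : M × ℤ → ℚ, IsModPeriodic q ∧ IsModPeriodic r ∧
      (∀ z, r (z.1, z.2 + 1) = r z) ∧ ∀ z, q (z.1, z.2 + 1) - q z + r z = p z := by
  have hp' := hp
  obtain ⟨s, hs, hps⟩ := hp
  have hs' : (s : ℚ) ≠ 0 := by positivity
  have hper : ∀ (x : M) (y : ℤ), p (x, y + s) = p (x, y) := fun x y => by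
    simpa using hps (x, y) (0, 1)
  have htr : ∀ j : ℤ, IsModPeriodic (fun z : M × ℤ => p (z.1, z.2 + j)) := fun j => by
    simpa [Prod.add_def] using hp'.translate ((0 : M), j)
  refine ⟨fun z => (∑ j ∈ Finset.range s, (j : ℚ) * p (z.1, z.2 + (j : ℕ))) / s,
    fun z => (∑ j ∈ Finset.range s, p (z.1, z.2 + (j + 1 : ℕ))) / s, ?_, ?_, ?_, ?_⟩
  · exact (IsModPeriodic.sum _ fun (j : ℕ) _ => (IsModPeriodic.const (j : ℚ)).map₂ (htr j)
      (· * ·)).map₂ (IsModPeriodic.const s) (· / ·)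
  · exact (IsModPeriodic.sum _ fun j _ => htr (j + 1 : ℕ)).map₂ (IsModPeriodic.const s) (· / ·)
  · rintro ⟨x, y⟩
    have h := Finset.sum_range_sub (fun j : ℕ => p (x, y + (j + 1 : ℕ))) s
    have h2 := hper x (y + 1)
    simp only [Finset.sum_sub_distrib] at h
    simp only
    congr 1
    have e1 : ∀ j : ℕ, y + 1 + ((j + 1 : ℕ) : ℤ) = y + ((j + 1 + 1 : ℕ) : ℤ) := fun j => by
      push_cast; ring
    have e2 : y + ((s + 1 : ℕ) : ℤ) = y + 1 + s := by push_cast; ring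
    simp only [e1]
    rw [e2, h2] at h
    simp only [zero_add, Nat.cast_one] at h
    linarith
  · rintro ⟨x, y⟩
    have h := sum_range_mul_sub (fun j : ℕ => p (x, y + j)) s
    simp only [mul_sub, Finset.sum_sub_distrib] at h
    have e1 : ∀ j : ℕ, y + 1 + (j : ℤ) = y + ((j + 1 : ℕ) : ℤ) := fun j => by
      push_cast; ring
    simp only [e1]
    rw [hper] at h
    field_simp
    linarith

theorem IsModPeriodic.mul_pow_mem_map_lastDiff (k : ℕ) {p : M × ℤ → ℚ} (hp : IsModPeriodic p) :
    (fun z : M × ℤ => p z * (z.2 : ℚ) ^ k) ∈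
      (Subalgebra.toSubmodule (quasiPoly (M × ℤ))).map (lastDiff M) := by
  induction k using Nat.strong_induction_on generalizing p with
  | _ k ih =>
    obtain ⟨q, r, hq, hr, hr1, hqr⟩ := hp.exists_lastDiff
    have hq1 : IsModPeriodic (fun z : M × ℤ => q (z.1, z.2 + 1)) := by
      simpa [Prod.add_def] using hq.translate ((0 : M), 1)
    have hy : (fun z : M × ℤ => (z.2 : ℚ)) ∈ quasiPoly (M × ℤ) :=
      linear_mem_quasiPoly (AddMonoidHom.snd M ℤ)
    have hmain : lastDiff M (fun z => q z * (z.2 : ℚ) ^ k + r z * (z.2 : ℚ) ^ (k + 1) *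
        (1 / (k + 1))) ∈ (Subalgebra.toSubmodule (quasiPoly (M × ℤ))).map (lastDiff M) :=
      Submodule.mem_map_of_mem ((Subalgebra.mem_toSubmodule _).2 <|
        add_mem (mul_mem hq.mem_quasiPoly (pow_mem hy k))
          (mul_mem (mul_mem hr.mem_quasiPoly (pow_mem hy (k + 1)))
            ((quasiPoly (M × ℤ)).algebraMap_mem _)))
    have hrest := sum_mem fun i (hi : i ∈ Finset.range k) => ih i (Finset.mem_range.1 hi)
      ((hq1.map₂ (IsModPeriodic.const (k.choose i : ℚ)) (· * ·)).map₂
        (hr.map₂ (IsModPeriodic.const (((k + 1).choose i : ℚ) / (k + 1))) (· * ·)) (· + ·))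
    convert sub_mem hmain hrest using 1
    ext z
    have e1 : ((z.2 : ℚ) + 1) ^ k =
        ∑ i ∈ Finset.range k, (z.2 : ℚ) ^ i * k.choose i + (z.2 : ℚ) ^ k := by
      rw [add_pow, Finset.sum_range_succ]; simp
    have e2 : ((z.2 : ℚ) + 1) ^ (k + 1) =
        ∑ i ∈ Finset.range k, (z.2 : ℚ) ^ i * (k + 1).choose i + (z.2 : ℚ) ^ k * (k + 1) +
          (z.2 : ℚ) ^ (k + 1) := by
      rw [add_pow, Finset.sum_range_succ, Finset.sum_range_succ]; simp
    have e3 : ∑ i ∈ Finset.range k, (q (z.1, z.2 + 1) * (k.choose i : ℚ) +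
          r z * (((k + 1).choose i : ℚ) / (k + 1))) * (z.2 : ℚ) ^ i =
        q (z.1, z.2 + 1) * ∑ i ∈ Finset.range k, (z.2 : ℚ) ^ i * k.choose i +
        r z / (k + 1) * ∑ i ∈ Finset.range k, (z.2 : ℚ) ^ i * (k + 1).choose i := by
      rw [Finset.mul_sum, Finset.mul_sum, ← Finset.sum_add_distrib]
      exact Finset.sum_congr rfl fun i _ => by ring
    have hk : (k : ℚ) + 1 ≠ 0 := by positivity
    simp only [Pi.sub_apply, Finset.sum_apply, lastDiff_apply, hr1]
    rw [e3, ← hqr z]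
    push_cast
    rw [e1, e2]
    field_simp
    ring

theorem hom_prod_int_apply (u : M × ℤ →+ ℤ) (x : M) (y : ℤ) :
    u (x, y) = u (x, 0) + u (0, 1) * y := by
  have h : ((x, y) : M × ℤ) = (x, 0) + y • (0, 1) := by simp
  rw [h, map_add, map_zsmul, smul_eq_mul, mul_comm]

theorem quasiPoly_mem_map_lastDiff {h : M × ℤ → ℚ} (hh : h ∈ quasiPoly (M × ℤ)) :
    h ∈ (Subalgebra.toSubmodule (quasiPoly (M × ℤ))).map (lastDiff M) := by
  let S : Set (M × ℤ → ℚ) := {f | ∃ a ∈ quasiPoly M, ∃ p, IsModPeriodic p ∧ ∃ k : ℕ,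
    f = fun z => a z.1 * (p z * (z.2 : ℚ) ^ k)}
  have hspan : h ∈ Submodule.span ℚ S := by
    refine adjoin_subset_span ?_ ?_ ?_ hh
    · exact Submodule.subset_span ⟨1, one_mem _, _, IsModPeriodic.const 1, 0, by ext; simp⟩
    · rintro _ ⟨a, ha, p, hp, k, rfl⟩ _ ⟨b, hb, q, hq, l, rfl⟩
      refine Submodule.subset_span ⟨a * b, mul_mem ha hb, _, hp.map₂ hq (· * ·), k + l, ?_⟩
      ext z
      simp only [Pi.mul_apply]
      ring
    · rintro _ (⟨φ, rfl⟩ | hg)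
      · have h1 : (fun z : M × ℤ => (φ (z.1, 0) : ℚ)) ∈ Submodule.span ℚ S :=
          Submodule.subset_span ⟨_, linear_mem_quasiPoly (φ.comp (AddMonoidHom.inl M ℤ)), _,
            IsModPeriodic.const 1, 0, by ext; simp⟩
        have h2 : (fun z : M × ℤ => (φ (0, 1) : ℚ) * z.2) ∈ Submodule.span ℚ S :=
          Submodule.subset_span ⟨1, one_mem _, _, IsModPeriodic.const (φ (0, 1) : ℚ), 1,
            by ext; simp⟩
        have e : (fun z : M × ℤ => (φ z : ℚ)) =
            (fun z => (φ (z.1, 0) : ℚ)) + fun z => (φ (0, 1) : ℚ) * z.2 := by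
          ext ⟨x, y⟩
          rw [hom_prod_int_apply]
          simp
        rw [e]
        exact add_mem h1 h2
      · exact Submodule.subset_span ⟨1, one_mem _, _, hg, 0, by ext; simp⟩
  refine Submodule.span_le.2 ?_ hspan
  rintro _ ⟨a, ha, p, hp, k, rfl⟩
  obtain ⟨H, hH, hpH⟩ := hp.mul_pow_mem_map_lastDiff k
  refine ⟨fun z => a z.1 * H z, (Subalgebra.mem_toSubmodule _).2 <|
    mul_mem (quasiPoly_comp ha (AddMonoidHom.fst M ℤ)) hH, ?_⟩
  ext z
  have := congrFun hpH z
  simp only [lastDiff_apply] at this ⊢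
  rw [← this]
  ring

theorem quasiPoly_comp_floor {H : M × ℤ → ℚ} (hH : H ∈ quasiPoly (M × ℤ)) (φ : M →+ ℤ) {b : ℤ}
    (hb : 0 < b) : (fun x => H (x, φ x / b + 1)) ∈ quasiPoly M := by
  lift b to ℕ using hb.le
  have hb' : 0 < b := by exact_mod_cast hb
  induction hH using Algebra.adjoin_induction with
  | mem g hg =>
    obtain ⟨ψ, rfl⟩ | ⟨s, hs, hg⟩ := hg
    · have hmod : IsModPeriodic (fun x => ((φ x % b : ℤ) : ℚ)) :=
        ⟨b, hb', fun x z => by simp⟩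
      have hc : (fun x => ((φ x / b + 1 : ℤ) : ℚ)) ∈ quasiPoly M := by
        convert add_mem (mul_mem (sub_mem (linear_mem_quasiPoly φ) hmod.mem_quasiPoly)
          ((quasiPoly M).algebraMap_mem (1 / b : ℚ))) (one_mem (quasiPoly M)) using 1
        ext x
        have h := Int.mul_ediv_add_emod (φ x) b
        have h' : (b : ℚ) * (φ x / b : ℤ) + (φ x % b : ℤ) = φ x := by exact_mod_cast h
        have hb0 : (b : ℚ) ≠ 0 := by positivity
        simp only [Pi.add_apply, Pi.mul_apply, Pi.sub_apply, Pi.one_apply, Pi.algebraMap_apply,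
          Algebra.algebraMap_self, RingHom.id_apply]
        rw [← h']
        push_cast
        field_simp
        ring
      convert add_mem (linear_mem_quasiPoly (ψ.comp (AddMonoidHom.inl M ℤ)))
        (mul_mem ((quasiPoly M).algebraMap_mem (ψ (0, 1) : ℚ)) hc) using 1
      ext x
      simp [hom_prod_int_apply ψ x (φ x / b + 1)]
    · refine IsModPeriodic.mem_quasiPoly ⟨b * s, Nat.mul_pos hb' hs, fun x z => ?_⟩
      have e : φ (x + (b * s) • z) / b + 1 = φ x / b + 1 + s * φ z := by
        rw [map_add, map_nsmul, nsmul_eq_mul]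
        push_cast
        rw [mul_assoc, Int.add_mul_ediv_left _ _ hb.ne']
        ring
      simp only [e]
      rw [← hg (x, φ x / b + 1) (b • z, φ z), Prod.smul_mk, Prod.mk_add_mk, smul_smul,
        nsmul_eq_mul, mul_comm b s]
  | algebraMap c => exact (quasiPoly M).algebraMap_mem c
  | add f g _ _ hf hg => exact add_mem hf hg
  | mul f g _ _ hf hg => exact mul_mem hf hg

/-- The function `1` and the indicators of half-spaces whose boundary is transverse to the last
coordinate. -/
def lastIndicators (M : Type*) [AddCommGroup M] : Set (M × ℤ → ℚ) :=
  {e | e = 1 ∨ ∃ u : M × ℤ →+ ℤ, u (0, 1) ≠ 0 ∧ e = posInd u}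

theorem posInd_mul_posInd_of_pos_mul (u v : M × ℤ →+ ℤ) (h : 0 < u (0, 1) * v (0, 1)) :
    ∃ a ∈ pwQuasiPoly M, ∀ z,
      posInd u z * posInd v z = (1 - a z.1) * posInd u z + a z.1 * posInd v z := by
  obtain ⟨ε, hu, hv⟩ : ∃ ε : ℤ, 0 < ε * u (0, 1) ∧ 0 < ε * v (0, 1) := by
    rcases pos_and_pos_or_neg_and_neg_of_mul_pos h with h | h
    · exact ⟨1, by simpa using h⟩
    · exact ⟨-1, by simpa using h⟩
  refine ⟨_, posInd_mem_pwQuasiPoly ((ε * v (0, 1)) • u.comp (AddMonoidHom.inl M ℤ) -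
    (ε * u (0, 1)) • v.comp (AddMonoidHom.inl M ℤ)), ?_⟩
  rintro ⟨x, y⟩
  have key : ε * v (0, 1) * u (x, 0) - ε * u (0, 1) * v (x, 0) =
      ε * v (0, 1) * u (x, y) - ε * u (0, 1) * v (x, y) := by
    rw [hom_prod_int_apply u x y, hom_prod_int_apply v x y]
    ring
  simp only [posInd, AddMonoidHom.sub_apply, AddMonoidHom.smul_apply, AddMonoidHom.comp_apply,
    AddMonoidHom.inl_apply, smul_eq_mul, key]
  split_ifs <;> first | (norm_num; done) | (exfalso; nlinarith)

theorem posInd_mul_posInd_of_neg_pos (u v : M × ℤ →+ ℤ) (hu : u (0, 1) < 0) (hv : 0 < v (0, 1)) :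
    ∃ a ∈ pwQuasiPoly M, ∀ z,
      posInd u z * posInd v z = a z.1 * posInd u z + a z.1 * posInd v z - a z.1 := by
  refine ⟨_, posInd_mem_pwQuasiPoly (v (0, 1) • u.comp (AddMonoidHom.inl M ℤ) -
    u (0, 1) • v.comp (AddMonoidHom.inl M ℤ)), ?_⟩
  rintro ⟨x, y⟩
  have key : v (0, 1) * u (x, 0) - u (0, 1) * v (x, 0) =
      v (0, 1) * u (x, y) - u (0, 1) * v (x, y) := by
    rw [hom_prod_int_apply u x y, hom_prod_int_apply v x y]
    ring
  simp only [posInd, AddMonoidHom.sub_apply, AddMonoidHom.smul_apply, AddMonoidHom.comp_apply,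
    AddMonoidHom.inl_apply, smul_eq_mul, key]
  split_ifs <;> first | (norm_num; done) | (exfalso; nlinarith)

theorem lastIndicators_mul {e e' : M × ℤ → ℚ} (he : e ∈ lastIndicators M)
    (he' : e' ∈ lastIndicators M) :
    ∃ a ∈ pwQuasiPoly M, ∃ b ∈ pwQuasiPoly M, ∃ c ∈ pwQuasiPoly M,
      ∀ z, e z * e' z = a z.1 * e z + b z.1 * e' z + c z.1 := by
  obtain rfl | ⟨u, hu, rfl⟩ := he
  · exact ⟨0, zero_mem _, 1, one_mem _, 0, zero_mem _, fun z => by simp⟩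
  obtain rfl | ⟨v, hv, rfl⟩ := he'
  · exact ⟨1, one_mem _, 0, zero_mem _, 0, zero_mem _, fun z => by simp⟩
  rcases lt_or_gt_of_ne (mul_ne_zero hu hv) with h | h
  · rcases mul_neg_iff.1 h with ⟨h1, h2⟩ | ⟨h1, h2⟩
    · obtain ⟨a, ha, H⟩ := posInd_mul_posInd_of_neg_pos v u h2 h1
      refine ⟨a, ha, a, ha, -a, neg_mem ha, fun z => ?_⟩
      rw [mul_comm, H, Pi.neg_apply]
      ring
    · obtain ⟨a, ha, H⟩ := posInd_mul_posInd_of_neg_pos u v h1 h2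
      refine ⟨a, ha, a, ha, -a, neg_mem ha, fun z => ?_⟩
      rw [H, Pi.neg_apply]
      ring
  · obtain ⟨a, ha, H⟩ := posInd_mul_posInd_of_pos_mul u v h
    exact ⟨1 - a, sub_mem (one_mem _) ha, a, ha, 0, zero_mem _, fun z => by rw [H]; simp⟩

theorem mul_posInd_mem_map_lastDiff {h : M × ℤ → ℚ} (hh : h ∈ quasiPoly (M × ℤ))
    {u : M × ℤ →+ ℤ} (hu : 0 < u (0, 1)) :
    (fun z => h z * posInd u z) ∈
      (Subalgebra.toSubmodule (pwQuasiPoly (M × ℤ))).map (lastDiff M) := by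
  obtain ⟨H, hH, hHh⟩ := quasiPoly_mem_map_lastDiff hh
  have hc := quasiPoly_comp_floor hH (-(u.comp (AddMonoidHom.inl M ℤ))) hu
  refine ⟨_, (Subalgebra.mem_toSubmodule _).2 <| mul_mem (sub_mem
    (mem_pwQuasiPoly_of_mem_quasiPoly hH) (mem_pwQuasiPoly_of_mem_quasiPoly
      (quasiPoly_comp hc (AddMonoidHom.fst M ℤ)))) (posInd_mem_pwQuasiPoly u), ?_⟩
  ext ⟨x, y⟩
  have hd := congrFun hHh (x, y)
  have hpos : ∀ y : ℤ, 0 < u (x, y) ↔ -u (x, 0) / u (0, 1) < y := fun y => by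
    rw [Int.ediv_lt_iff_lt_mul hu, hom_prod_int_apply u x y]
    constructor <;> intro h <;> linarith
  simp only [lastDiff_apply, Pi.mul_apply, Pi.sub_apply, AddMonoidHom.coe_fst,
    AddMonoidHom.neg_apply, AddMonoidHom.comp_apply, AddMonoidHom.inl_apply, posInd, hpos]
    at hd ⊢
  generalize -u (x, 0) / u (0, 1) = c
  rcases lt_trichotomy c y with h1 | h1 | h1
  · rw [if_pos h1, if_pos (by omega), ← hd]
    ring
  · subst h1
    rw [if_pos (lt_add_one c), if_neg (lt_irrefl c), ← hd]
    ring
  · rw [if_neg (by omega), if_neg (by omega)]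
    ring

theorem lastIndicators_mem_map_lastDiff {h e : M × ℤ → ℚ} (hh : h ∈ quasiPoly (M × ℤ))
    (he : e ∈ lastIndicators M) :
    (fun z => h z * e z) ∈
      (Subalgebra.toSubmodule (pwQuasiPoly (M × ℤ))).map (lastDiff M) := by
  obtain rfl | ⟨u, hu, rfl⟩ := he
  · obtain ⟨H, hH, rfl⟩ := quasiPoly_mem_map_lastDiff hh
    exact ⟨H, mem_pwQuasiPoly_of_mem_quasiPoly hH, by ext; simp⟩
  rcases hu.lt_or_gt with hu | hu
  · let T : M × ℤ →+ M × ℤ :=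
      (AddMonoidHom.fst M ℤ).prod (-AddMonoidHom.snd M ℤ)
    have hT : ∀ z, T z = (z.1, -z.2) := fun _ => rfl
    have huT : 0 < (u.comp T) (0, 1) := by
      have := hom_prod_int_apply u 0 (-1)
      rw [AddMonoidHom.comp_apply, hT, this, Prod.mk_zero_zero, map_zero]
      linarith
    obtain ⟨G, hG, hGf⟩ := mul_posInd_mem_map_lastDiff (quasiPoly_comp hh T) huT
    refine ⟨_, (Subalgebra.mem_toSubmodule _).2 <| neg_mem <| add_mem
      (pwQuasiPoly_comp hG T) (mul_mem (mem_pwQuasiPoly_of_mem_quasiPoly hh)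
        (posInd_mem_pwQuasiPoly u)), ?_⟩
    ext ⟨x, y⟩
    have h1 := congrFun hGf (x, -(y + 1))
    have h2 := congrFun hGf (x, -y)
    simp only [lastDiff_apply, posInd, AddMonoidHom.comp_apply, hT, neg_neg, Pi.neg_apply,
      Pi.add_apply, Pi.mul_apply] at h1 h2 ⊢
    rw [show -(y + 1) + 1 = -y by ring] at h1
    linarith
  · exact mul_posInd_mem_map_lastDiff hh hu

theorem pwQuasiPoly_mem_map_lastDiff {f : M × ℤ → ℚ} (hf : f ∈ pwQuasiPoly (M × ℤ)) :
    f ∈ (Subalgebra.toSubmodule (pwQuasiPoly (M × ℤ))).map (lastDiff M) := by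
  let S : Set (M × ℤ → ℚ) := {f | ∃ a ∈ pwQuasiPoly M, ∃ h ∈ quasiPoly (M × ℤ),
    ∃ e ∈ lastIndicators M, f = fun z => a z.1 * (h z * e z)}
  have hspan : f ∈ Submodule.span ℚ S := by
    refine adjoin_subset_span ?_ ?_ ?_ hf
    · exact Submodule.subset_span ⟨1, one_mem _, 1, one_mem _, 1, Or.inl rfl, by ext; simp⟩
    · rintro _ ⟨a, ha, h, hh, e, he, rfl⟩ _ ⟨a', ha', h', hh', e', he', rfl⟩
      obtain ⟨b, hb, b', hb', c, hc, H⟩ := lastIndicators_mul he he'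
      have hS : ∀ d ∈ pwQuasiPoly M, ∀ i ∈ lastIndicators M,
          (fun z : M × ℤ => (a * a' * d) z.1 * ((h * h') z * i z)) ∈ Submodule.span ℚ S :=
        fun d hd i hi => Submodule.subset_span
          ⟨_, mul_mem (mul_mem ha ha') hd, _, mul_mem hh hh', i, hi, rfl⟩
      convert add_mem (add_mem (hS b hb e he) (hS b' hb' e' he')) (hS c hc 1 (Or.inl rfl)) using 1
      ext z
      have := H z
      simp only [Pi.mul_apply, Pi.add_apply, Pi.one_apply]
      linear_combination a z.1 * a' z.1 * h z * h' z * this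
    · rintro _ (hg | ⟨u, rfl⟩)
      · exact Submodule.subset_span ⟨1, one_mem _, _, hg, 1, Or.inl rfl, by ext; simp⟩
      · by_cases hu : u (0, 1) = 0
        · refine Submodule.subset_span ⟨_, posInd_mem_pwQuasiPoly
            (u.comp (AddMonoidHom.inl M ℤ)), 1, one_mem _, 1, Or.inl rfl, ?_⟩
          ext ⟨x, y⟩
          have e : u (x, y) = u.comp (AddMonoidHom.inl M ℤ) x := by
            simp [hom_prod_int_apply u x y, hu]
          simp only [posInd, e, Pi.one_apply, mul_one]
        · exact Submodule.subset_span
            ⟨1, one_mem _, 1, one_mem _, _, Or.inr ⟨u, hu, rfl⟩, by ext; simp⟩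
  refine Submodule.span_le.2 ?_ hspan
  rintro _ ⟨a, ha, h, hh, e, he, rfl⟩
  obtain ⟨G, hG, hGf⟩ := lastIndicators_mem_map_lastDiff hh he
  refine ⟨fun z => a z.1 * G z, (Subalgebra.mem_toSubmodule _).2 <|
    mul_mem (pwQuasiPoly_comp ha (AddMonoidHom.fst M ℤ)) hG, ?_⟩
  ext z
  have := congrFun hGf z
  simp only [lastDiff_apply] at this ⊢
  rw [← this]
  ring

theorem sum_Ioo_mem_pwQuasiPoly {f : M × ℤ → ℚ} (hf : f ∈ pwQuasiPoly (M × ℤ)) (τ : M →+ ℤ) :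
    (fun x => ∑ y ∈ Finset.Ioo 0 (τ x), f (x, y)) ∈ pwQuasiPoly M := by
  obtain ⟨G, hG, hGf⟩ := pwQuasiPoly_mem_map_lastDiff hf
  have h0 := pwQuasiPoly_comp (sub_mem (neg_mem hG) hf) (AddMonoidHom.inl M ℤ)
  have h1 := pwQuasiPoly_comp hG ((AddMonoidHom.id M).prod τ)
  convert mul_mem (posInd_mem_pwQuasiPoly τ) (add_mem h1 h0) using 1
  ext x
  have hd : ∀ y, G (x, y + 1) - G (x, y) = f (x, y) := fun y => congrFun hGf (x, y)
  simp only [posInd, Pi.mul_apply, Pi.add_apply, Pi.sub_apply, Pi.neg_apply,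
    AddMonoidHom.inl_apply, AddMonoidHom.prod_apply, AddMonoidHom.id_apply]
  split_ifs with hτ
  · have key : ∀ n : ℕ, ∑ y ∈ Finset.Ioo (0 : ℤ) (n + 1), f (x, y) =
        G (x, n + 1) - G (x, 0) - f (x, 0) := by
      intro n
      induction n with
      | zero =>
        have := hd 0
        rw [zero_add] at this
        simp [← this, show Finset.Ioo (0 : ℤ) 1 = ∅ from rfl]
      | succ n ih =>
        have e : Finset.Ioo (0 : ℤ) ((n + 1 : ℕ) + 1) =
            insert ((n : ℤ) + 1) (Finset.Ioo 0 ((n : ℤ) + 1)) := by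
          ext y
          simp only [Finset.mem_Ioo, Finset.mem_insert]
          push_cast
          omega
        rw [e, Finset.sum_insert (by simp), ih, ← hd (n + 1)]
        push_cast
        ring
    have := key (τ x - 1).toNat
    rw [Int.toNat_of_nonneg (by omega), sub_add_cancel] at this
    rw [this]
    ring
  · rw [Finset.Ioo_eq_empty (by simpa using hτ)]
    simp

/-- The additive homomorphism splitting off the first coordinate as the last factor. -/
def finConsHom (M : Type*) [AddCommGroup M] (n : ℕ) :
    (M × (Fin n → ℤ)) × ℤ →+ M × (Fin (n + 1) → ℤ) where
  toFun z := (z.1.1, Fin.cons z.2 z.1.2)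
  map_zero' := by
    ext i
    · rfl
    · refine Fin.cases ?_ (fun i => ?_) i <;> simp
  map_add' a b := by
    ext i
    · rfl
    · refine Fin.cases ?_ (fun i => ?_) i <;> simp

theorem sum_piFinset_mem_pwQuasiPoly (n : ℕ) {f : M × (Fin n → ℤ) → ℚ}
    (hf : f ∈ pwQuasiPoly (M × (Fin n → ℤ))) (τ : M →+ ℤ) :
    (fun x => ∑ y ∈ Fintype.piFinset fun _ : Fin n => Finset.Ioo 0 (τ x), f (x, y)) ∈
      pwQuasiPoly M := by
  induction n with
  | zero =>
    convert pwQuasiPoly_comp hf (AddMonoidHom.inl M (Fin 0 → ℤ)) using 1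
    ext x
    rw [Finset.sum_eq_single_of_mem 0 (Fintype.mem_piFinset.2 finZeroElim)
      fun y _ hy => absurd (Subsingleton.elim y 0) hy]
    rfl
  | succ n ih =>
    have h := ih (sum_Ioo_mem_pwQuasiPoly (pwQuasiPoly_comp hf (finConsHom M n))
      (τ.comp (AddMonoidHom.fst M (Fin n → ℤ))))
    convert h using 1
    ext x
    change _ = ∑ y ∈ _, ∑ y₀ ∈ Finset.Ioo 0 (τ x), f (finConsHom M n ((x, y), y₀))
    rw [← Finset.sum_product']
    refine Finset.sum_bij' (fun y _ => (Fin.tail y, y 0)) (fun z _ => Fin.cons z.2 z.1)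
      ?_ ?_ ?_ ?_ ?_
    · intro y hy
      simp only [Fintype.mem_piFinset] at hy
      simp only [Finset.mem_product, Fintype.mem_piFinset]
      exact ⟨fun i => hy i.succ, hy 0⟩
    · rintro ⟨y, y₀⟩ hy
      simp only [Finset.mem_product, Fintype.mem_piFinset] at hy ⊢
      exact fun i => Fin.cases hy.2 (fun i => by simpa using hy.1 i) i
    · intro y _
      simp
    · rintro ⟨y, y₀⟩ _
      simp
    · intro y _
      simp [finConsHom]

theorem indicator_forall_mem_pwQuasiPoly {ι : Type*} [Fintype ι] {P : ι → M → Prop}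
    (h : ∀ i, Set.indicator {x | P i x} 1 ∈ pwQuasiPoly M) :
    Set.indicator {x | ∀ i, P i x} 1 ∈ pwQuasiPoly M := by
  classical
  convert prod_mem (t := Finset.univ) fun i _ => h i using 1
  ext x
  simp [Set.indicator_apply, Finset.prod_apply, Finset.prod_ite_zero]

/-- The algebra of functions on `ℤ` which agree with a quasipolynomial at positive integers. -/
def posQuasiPoly : Subalgebra ℚ (ℤ → ℚ) where
  carrier := {f | ∃ s : ℕ, 0 < s ∧ ∃ p : ℕ → Polynomial ℚ,
    ∀ t : ℕ, 0 < t → f t = (p (t % s)).eval (t : ℚ)}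
  algebraMap_mem' c := ⟨1, one_pos, fun _ => Polynomial.C c, fun t _ => by simp⟩
  add_mem' := by
    rintro f g ⟨s₁, h₁, p, hp⟩ ⟨s₂, h₂, q, hq⟩
    refine ⟨s₁ * s₂, Nat.mul_pos h₁ h₂, fun i => p (i % s₁) + q (i % s₂), fun t ht => ?_⟩
    simp only
    rw [Nat.mod_mul_right_mod, Nat.mod_mul_left_mod, Polynomial.eval_add, ← hp t ht, ← hq t ht,
      Pi.add_apply]
  mul_mem' := by
    rintro f g ⟨s₁, h₁, p, hp⟩ ⟨s₂, h₂, q, hq⟩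
    refine ⟨s₁ * s₂, Nat.mul_pos h₁ h₂, fun i => p (i % s₁) * q (i % s₂), fun t ht => ?_⟩
    simp only
    rw [Nat.mod_mul_right_mod, Nat.mod_mul_left_mod, Polynomial.eval_mul, ← hp t ht, ← hq t ht,
      Pi.mul_apply]

theorem pwQuasiPoly_int_le : pwQuasiPoly ℤ ≤ posQuasiPoly := by
  have hlin : ∀ (φ : ℤ →+ ℤ) (t : ℕ), φ t = t * φ 1 := fun φ t => by
    simpa using map_nsmul φ t 1
  refine Algebra.adjoin_le (Set.union_subset (Algebra.adjoin_le ?_ : quasiPoly ℤ ≤ _) ?_)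
  · rintro g (⟨φ, rfl⟩ | ⟨s, hs, hg⟩)
    · exact ⟨1, one_pos, fun _ => Polynomial.X * Polynomial.C (φ 1 : ℚ), fun t _ => by
        simp [hlin]⟩
    · refine ⟨s, hs, fun i => Polynomial.C (g i), fun t _ => ?_⟩
      have := hg ((t % s : ℕ) : ℤ) ((t / s : ℕ) : ℤ)
      rw [nsmul_eq_mul, ← Nat.cast_mul, ← Nat.cast_add, Nat.mod_add_div] at this
      rw [Polynomial.eval_C, this]
  · rintro _ ⟨φ, rfl⟩
    refine ⟨1, one_pos, fun _ => Polynomial.C (posInd φ 1), fun t ht => ?_⟩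
    have ht' : (0 : ℤ) < t := by exact_mod_cast ht
    rw [Polynomial.eval_C, posInd, posInd, hlin]
    simp only [mul_pos_iff_of_pos_left ht']

end PiecewiseQuasipolynomials

section Rulers

theorem indicator_and_mem_pwQuasiPoly {M : Type*} [AddCommGroup M] {P Q : M → Prop}
    (hP : Set.indicator {x | P x} 1 ∈ pwQuasiPoly M)
    (hQ : Set.indicator {x | Q x} 1 ∈ pwQuasiPoly M) :
    Set.indicator {x | P x ∧ Q x} 1 ∈ pwQuasiPoly M := by
  convert mul_mem hP hQ using 1
  rw [← Set.inter_indicator_one, Set.ofPred_and]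

theorem indicator_pos_mem_pwQuasiPoly {M : Type*} [AddCommGroup M] (φ : M →+ ℤ) :
    Set.indicator {x | 0 < φ x} 1 ∈ pwQuasiPoly M := by
  convert posInd_mem_pwQuasiPoly φ using 1
  ext x
  simp [posInd, Set.indicator_apply]

theorem indicator_ne_mem_pwQuasiPoly {M : Type*} [AddCommGroup M] (φ : M →+ ℤ) :
    Set.indicator {x | φ x ≠ 0} 1 ∈ pwQuasiPoly M := by
  convert add_mem (posInd_mem_pwQuasiPoly φ) (posInd_mem_pwQuasiPoly (-φ)) using 1
  ext x
  rcases lt_trichotomy (φ x) 0 with h | h | h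
  · simp [posInd, h, h.ne, h.le]
  · simp [posInd, h]
  · simp [posInd, h, h.ne', h.le]

/-- The markings `0, y 0, …, y (n - 1), t`. -/
def markings (n : ℕ) : ℤ × (Fin n → ℤ) →+ (Fin (n + 1 + 1) → ℤ) where
  toFun z := Fin.cons 0 (Fin.snoc (α := fun _ => ℤ) z.2 z.1)
  map_zero' := by
    ext i
    refine Fin.cases rfl (fun i => ?_) i
    refine Fin.lastCases ?_ (fun i => ?_) i <;> simp
  map_add' a b := by
    ext i
    refine Fin.cases rfl (fun i => ?_) i
    refine Fin.lastCases ?_ (fun i => ?_) i <;> simp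

theorem markings_zero (n : ℕ) (z : ℤ × (Fin n → ℤ)) : markings n z 0 = 0 := rfl

theorem markings_last (n : ℕ) (z : ℤ × (Fin n → ℤ)) : markings n z (Fin.last n).succ = z.1 := by
  simp [markings]

theorem markings_castSucc (n : ℕ) (z : ℤ × (Fin n → ℤ)) (i : Fin n) :
    markings n z i.castSucc.succ = z.2 i := by
  simp [markings]

theorem eq_markings_iff (n : ℕ) (z : ℤ × (Fin n → ℤ)) (x : Fin (n + 1 + 1) → ℤ) :
    x = markings n z ↔
      x 0 = 0 ∧ x (Fin.last n).succ = z.1 ∧ ∀ i : Fin n, x i.castSucc.succ = z.2 i := by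
  constructor
  · rintro rfl
    exact ⟨markings_zero n z, markings_last n z, markings_castSucc n z⟩
  · rintro ⟨h0, h1, h2⟩
    ext i
    refine Fin.cases h0 (fun i => ?_) i
    refine Fin.lastCases ?_ (fun i => ?_) i
    · rw [h1, markings_last]
    · rw [h2, markings_castSucc]

theorem strictMono_markings_iff (n : ℕ) {t : ℤ} (ht : 0 < t) (y : Fin n → ℤ) :
    StrictMono (markings n (t, y)) ↔ (∀ i, y i ∈ Finset.Ioo 0 t) ∧ StrictMono y := by
  constructor
  · intro h
    refine ⟨fun i => Finset.mem_Ioo.2 ⟨?_, ?_⟩, fun i j hij => ?_⟩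
    · have := h (Fin.succ_pos i.castSucc)
      rwa [markings_zero, markings_castSucc] at this
    · have := h (Fin.succ_lt_succ_iff.2 (Fin.castSucc_lt_last i))
      rwa [markings_last, markings_castSucc] at this
    · have := h (Fin.succ_lt_succ_iff.2 (Fin.castSucc_lt_castSucc_iff.2 hij))
      rwa [markings_castSucc, markings_castSucc] at this
  · rintro ⟨h1, h2⟩ i j
    simp only [Finset.mem_Ioo] at h1
    refine Fin.cases ?_ (fun i => ?_) i <;> refine Fin.cases ?_ (fun j => ?_) j
    · simp
    · intro _
      refine Fin.lastCases ?_ (fun j => ?_) j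
      · rwa [markings_zero, markings_last]
      · rw [markings_zero, markings_castSucc]
        exact (h1 j).1
    · simp
    · refine Fin.lastCases ?_ (fun i => ?_) i <;> refine Fin.lastCases ?_ (fun j => ?_) j
      · simp
      · intro h
        exact absurd (Fin.succ_lt_succ_iff.1 h) (Fin.le_last _).not_gt
      · intro _
        rw [markings_last, markings_castSucc]
        exact (h1 i).2
      · intro h
        rw [markings_castSucc, markings_castSucc]
        exact h2 (by simpa using h)

/-- The sum over a multiset of indices, as a linear form. -/
def multisetSum {k : ℕ} (r : Multiset (Fin k)) : (Fin k → ℤ) →+ ℤ where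
  toFun x := (r.map x).sum
  map_zero' := by simp
  map_add' x y := by simp [Multiset.sum_map_add]

theorem multisetSum_single {k : ℕ} (r : Multiset (Fin k)) (j : Fin k) :
    multisetSum r (Pi.single j 1) = r.count j := by
  change (r.map (Pi.single j 1 : Fin k → ℤ)).sum = r.count j
  induction r using Multiset.induction_on with
  | empty => simp
  | cons a r ih =>
    rw [Multiset.map_cons, Multiset.sum_cons, ih, Multiset.count_cons, Pi.single_apply]
    by_cases h : a = j
    · simp [h, add_comm]
    · simp [h, Ne.symm h]

/-- The difference of the sums of the markings over two multisets. -/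
def sumDiff (n : ℕ) (r s : Multiset (Fin (n + 1 + 1))) : ℤ × (Fin n → ℤ) →+ ℤ :=
  (multisetSum r - multisetSum s).comp (markings n)

theorem sumDiff_ne_zero (n : ℕ) {r s : Multiset (Fin (n + 1 + 1))}
    (hc : Multiset.card r = Multiset.card s) (hrs : r ≠ s) : sumDiff n r s ≠ 0 := by
  intro h
  apply hrs
  have key : ∀ (z : ℤ × (Fin n → ℤ)) (j : Fin (n + 1 + 1)), Pi.single j 1 = markings n z →
      r.count j = s.count j := by
    intro z j hj
    have := DFunLike.congr_fun h z
    rw [sumDiff, AddMonoidHom.comp_apply, ← hj, AddMonoidHom.sub_apply, multisetSum_single,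
      multisetSum_single, AddMonoidHom.zero_apply, sub_eq_zero] at this
    exact_mod_cast this
  have hsucc : ∀ j : Fin (n + 1), r.count j.succ = s.count j.succ := by
    intro j
    refine Fin.lastCases ?_ (fun i => ?_) j
    · refine key (1, 0) _ ((eq_markings_iff _ _ _).2 ⟨?_, ?_, fun i => ?_⟩)
      · simp
      · simp
      · simp [(Fin.castSucc_lt_last i).ne]
    · refine key (0, Pi.single i 1) _ ((eq_markings_iff _ _ _).2 ⟨?_, ?_, fun i' => ?_⟩)
      · simp
      · simp
      · simp [Pi.single_apply]
  have h0 : r.count 0 = s.count 0 := by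
    rw [← Multiset.sum_count_eq_card (s := Finset.univ) fun a _ => Finset.mem_univ a,
      ← Multiset.sum_count_eq_card (s := Finset.univ) fun a _ => Finset.mem_univ a,
      Fin.sum_univ_succ, Fin.sum_univ_succ (f := fun a => s.count a)] at hc
    simp only [hsucc] at hc
    omega
  exact Multiset.ext.2 (Fin.cases h0 hsucc)

/-- A nonzero linear form vanishes on `O(t ^ (n - 1))` of the points of `(0, t) ^ n`. -/
theorem mul_card_zeros_le (n : ℕ) {u : ℤ × (Fin n → ℤ) →+ ℤ} (hu : u ≠ 0) {t : ℕ} (ht : 0 < t) :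
    t * ((Fintype.piFinset fun _ : Fin n => Finset.Ioo (0 : ℤ) t).filter
      fun y => u ((t : ℤ), y) = 0).card ≤ t ^ n := by
  by_cases h : ∃ i, u (0, Pi.single i 1) ≠ 0
  · obtain ⟨i, hi⟩ := h
    have hcard : (Finset.Ico (0 : ℤ) t).card = t := by simp
    have hpow := Fintype.card_piFinset_const (Finset.Ico (0 : ℤ) t) n
    rw [hcard] at hpow
    rw [← hpow, ← hcard, ← Finset.card_product, hcard]
    refine Finset.card_le_card_of_injOn (fun z => Function.update z.2 i z.1) ?_ ?_
    · rintro ⟨k, y⟩ hz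
      simp only [Finset.coe_product, Set.mem_prod, Finset.mem_coe, Finset.mem_filter,
        Fintype.mem_piFinset] at hz ⊢
      intro j
      by_cases hj : j = i
      · subst hj
        simpa using hz.1
      · rw [Function.update_of_ne hj]
        exact Finset.Ioo_subset_Ico_self (hz.2.1 j)
    · rintro ⟨k, y⟩ hz ⟨k', y'⟩ hz' he
      simp only [Finset.coe_product, Set.mem_prod, Finset.mem_coe, Finset.mem_filter] at hz hz' he
      have hk : k = k' := by simpa using congrFun he i
      have hy : (((t : ℤ), y') : ℤ × (Fin n → ℤ)) =
          ((t : ℤ), y) + (y' i - y i) • (0, Pi.single i 1) := by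
        ext j
        · simp
        · by_cases hj : j = i
          · subst hj
            simp
          · have := congrFun he j
            rw [Function.update_of_ne hj, Function.update_of_ne hj] at this
            simp [hj, this]
      have h2 := hz'.2.2
      rw [hy, map_add, hz.2.2, map_zsmul, zero_add, smul_eq_mul] at h2
      rw [(mul_eq_zero.1 h2).resolve_right hi, zero_smul, add_zero] at hy
      rw [hk, (Prod.mk.inj hy).2]
  · push Not at h
    have hr : u.comp (AddMonoidHom.inr ℤ (Fin n → ℤ)) = 0 :=
      AddMonoidHom.functions_ext _ _ _ fun i x => by
        have : ((0, Pi.single i x) : ℤ × (Fin n → ℤ)) = x • (0, Pi.single i 1) := by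
          rw [Prod.smul_mk, smul_zero, ← Pi.single_smul, smul_eq_mul, mul_one]
        rw [AddMonoidHom.comp_apply, AddMonoidHom.inr_apply, this, map_zsmul, h, smul_zero]
        rfl
    have hut : ∀ t y, u (t, y) = t * u (1, 0) := fun t y => by
      have e : ((t, y) : ℤ × (Fin n → ℤ)) = t • (1, 0) + (0, y) := by simp
      have := DFunLike.congr_fun hr y
      simp only [AddMonoidHom.comp_apply, AddMonoidHom.inr_apply, AddMonoidHom.zero_apply] at this
      rw [e, map_add, map_zsmul, this, add_zero, smul_eq_mul]
    have h1 : u (1, 0) ≠ 0 := fun h1 => hu (AddMonoidHom.ext fun z => by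
      rw [← Prod.mk.eta (p := z), hut, h1, mul_zero, AddMonoidHom.zero_apply])
    rw [Finset.filter_false_of_mem]
    · simp
    · intro y _
      rw [hut]
      exact mul_ne_zero (by exact_mod_cast ht.ne') h1

theorem card_strictMono (n : ℕ) (A : Finset ℤ) :
    ((Fintype.piFinset fun _ : Fin n => A).filter StrictMono).card = A.card.choose n := by
  rw [← Finset.card_powersetCard]
  have hcard : ∀ y : Fin n → ℤ, StrictMono y → (Finset.univ.image y).card = n := fun y hy => by
    rw [Finset.card_image_of_injective _ hy.injective, Finset.card_univ, Fintype.card_fin]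
  refine Finset.card_bij (fun y _ => Finset.univ.image y) ?_ ?_ ?_
  · intro y hy
    rw [Finset.mem_filter, Fintype.mem_piFinset] at hy
    refine Finset.mem_powersetCard.2 ⟨?_, hcard y hy.2⟩
    rintro _ ha
    obtain ⟨i, -, rfl⟩ := Finset.mem_image.1 ha
    exact hy.1 i
  · intro y hy y' hy' he
    rw [Finset.mem_filter] at hy hy'
    rw [Finset.orderEmbOfFin_unique (hcard y hy.2) (f := y) (by simp) hy.2,
      Finset.orderEmbOfFin_unique (hcard y hy.2) (f := y') (by simp [he]) hy'.2]
  · intro s hs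
    obtain ⟨hs, hn⟩ := Finset.mem_powersetCard.1 hs
    refine ⟨s.orderEmbOfFin hn, Finset.mem_filter.2 ⟨?_, OrderEmbedding.strictMono _⟩, ?_⟩
    · exact Fintype.mem_piFinset.2 fun i => hs (Finset.orderEmbOfFin_mem s hn i)
    · rw [← Finset.coe_inj]
      simp

/-- Pairs of distinct multisets of `h` indices. -/
abbrev DistinctPairs (k h : ℕ) : Type := {p : Sym (Fin k) h × Sym (Fin k) h // p.1 ≠ p.2}

theorem isBhSet_markings_iff (n h : ℕ) (z : ℤ × (Fin n → ℤ)) :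
    IsBhSet (n + 1) h (markings n z) ↔
      ∀ p : DistinctPairs (n + 1 + 1) h, sumDiff n p.1.1 p.1.2 z ≠ 0 := by
  constructor
  · rintro H ⟨⟨r, s⟩, hp⟩ h0
    exact H r s r.2 s.2 (fun e => hp (Subtype.ext e)) (sub_eq_zero.1 h0)
  · intro H r s hr hs hrs h0
    exact H ⟨(⟨r, hr⟩, ⟨s, hs⟩), fun e => hrs (congrArg Subtype.val e)⟩ (sub_eq_zero.2 h0)

open Classical in
theorem bmh_eq_card (n h : ℕ) {t : ℤ} (ht : 0 < t) :
    bmh (n + 1) h t = ((Fintype.piFinset fun _ : Fin n => Finset.Ioo 0 t).filter fun y =>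
      StrictMono (markings n (t, y)) ∧ IsBhSet (n + 1) h (markings n (t, y))).card := by
  rw [bmh, ← Nat.card_eq_finsetCard]
  have hx : ∀ x, IsRuler (n + 1) t x → x = markings n (t, fun i => x i.castSucc.succ) :=
    fun x hx => (eq_markings_iff _ _ _).2 ⟨hx.2.1, hx.2.2, fun _ => rfl⟩
  refine Nat.card_congr ⟨fun x => ⟨fun i => x.1 i.castSucc.succ, ?_⟩,
    fun y => ⟨markings n (t, y), ?_⟩, ?_, ?_⟩
  · rw [Finset.mem_filter, Fintype.mem_piFinset, ← hx _ x.2.1]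
    refine ⟨((strictMono_markings_iff n ht _).1 ?_).1, x.2.1.1, x.2.2⟩
    rw [← hx _ x.2.1]
    exact x.2.1.1
  · have hy := (Finset.mem_filter.1 y.2).2
    exact ⟨⟨hy.1, markings_zero _ _, markings_last _ _⟩, hy.2⟩
  · exact fun x => Subtype.ext (hx _ x.2.1).symm
  · exact fun y => Subtype.ext (funext fun i => markings_castSucc _ _ i)

theorem exists_eval_eq_bmh (n h : ℕ) :
    ∃ s : ℕ, 0 < s ∧ ∃ p : ℕ → Polynomial ℚ,
      ∀ t : ℕ, 0 < t → (bmh (n + 1) h t : ℚ) = (p (t % s)).eval (t : ℚ) := by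
  classical
  have hmono : Set.indicator {z | ∀ i : Fin (n + 1),
      0 < (((Pi.evalAddMonoidHom (fun _ => ℤ) i.succ) -
        (Pi.evalAddMonoidHom (fun _ => ℤ) i.castSucc)).comp (markings n)) z} 1 ∈
      pwQuasiPoly (ℤ × (Fin n → ℤ)) :=
    indicator_forall_mem_pwQuasiPoly fun i => indicator_pos_mem_pwQuasiPoly _
  have hsum : Set.indicator {z | ∀ p : DistinctPairs (n + 1 + 1) h,
      sumDiff n p.1.1 p.1.2 z ≠ 0} 1 ∈ pwQuasiPoly (ℤ × (Fin n → ℤ)) :=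
    indicator_forall_mem_pwQuasiPoly fun p => indicator_ne_mem_pwQuasiPoly _
  obtain ⟨s, hs, p, hp⟩ := pwQuasiPoly_int_le (sum_piFinset_mem_pwQuasiPoly n
    (indicator_and_mem_pwQuasiPoly hmono hsum) (AddMonoidHom.id ℤ))
  refine ⟨s, hs, p, fun t ht => ?_⟩
  rw [← hp t ht, bmh_eq_card n h (by exact_mod_cast ht), Finset.card_filter, Nat.cast_sum]
  refine Finset.sum_congr rfl fun y _ => ?_
  have hiff : StrictMono (markings n ((t : ℤ), y)) ∧ IsBhSet (n + 1) h (markings n ((t : ℤ), y)) ↔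
      (∀ i : Fin (n + 1), 0 < (((Pi.evalAddMonoidHom (fun _ => ℤ) i.succ) -
        (Pi.evalAddMonoidHom (fun _ => ℤ) i.castSucc)).comp (markings n)) ((t : ℤ), y)) ∧
      ∀ p : DistinctPairs (n + 1 + 1) h, sumDiff n p.1.1 p.1.2 ((t : ℤ), y) ≠ 0 := by
    rw [isBhSet_markings_iff, Fin.strictMono_iff_lt_succ]
    simp
  simp [Set.indicator_apply, hiff]

theorem bmh_bounds (n h : ℕ) : ∃ K : ℕ, ∀ t : ℕ, 0 < t →
    bmh (n + 1) h t ≤ (t - 1).choose n ∧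
      t * (t - 1).choose n ≤ t * bmh (n + 1) h t + K * t ^ n := by
  classical
  refine ⟨Fintype.card (DistinctPairs (n + 1 + 1) h), fun t ht => ?_⟩
  have ht' : (0 : ℤ) < t := by exact_mod_cast ht
  have hcard := card_strictMono n (Finset.Ioo 0 (t : ℤ))
  have htc : (Finset.Ioo 0 (t : ℤ)).card = t - 1 := by rw [Int.card_Ioo]; omega
  have hset : ((Fintype.piFinset fun _ : Fin n => Finset.Ioo 0 (t : ℤ)).filter StrictMono) =
      (Fintype.piFinset fun _ : Fin n => Finset.Ioo 0 (t : ℤ)).filter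
        fun y => StrictMono (markings n (t, y)) :=
    Finset.filter_congr fun y hy => by
      rw [strictMono_markings_iff n ht', ← Fintype.mem_piFinset (t := fun _ => Finset.Ioo 0 (t : ℤ)),
        and_iff_right hy]
  rw [htc, hset] at hcard
  rw [bmh_eq_card n h ht', ← hcard]
  refine ⟨Finset.card_le_card (Finset.monotone_filter_right _ fun y _ hy => hy.1), ?_⟩
  set B := Fintype.piFinset fun _ : Fin n => Finset.Ioo 0 (t : ℤ)
  have hsub : B.filter (fun y => StrictMono (markings n (t, y))) ⊆
      B.filter (fun y => StrictMono (markings n (t, y)) ∧ IsBhSet (n + 1) h (markings n (t, y))) ∪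
        Finset.univ.biUnion fun p : DistinctPairs (n + 1 + 1) h =>
          B.filter fun y => sumDiff n p.1.1 p.1.2 (t, y) = 0 := by
    intro y hy
    rw [Finset.mem_filter] at hy
    by_cases hB : IsBhSet (n + 1) h (markings n (t, y))
    · exact Finset.mem_union_left _ (Finset.mem_filter.2 ⟨hy.1, hy.2, hB⟩)
    · rw [isBhSet_markings_iff] at hB
      push Not at hB
      obtain ⟨p, hp⟩ := hB
      exact Finset.mem_union_right _ (Finset.mem_biUnion.2
        ⟨p, Finset.mem_univ p, Finset.mem_filter.2 ⟨hy.1, hp⟩⟩)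
  calc t * _ ≤ t * (_ + ∑ p : DistinctPairs (n + 1 + 1) h,
        (B.filter fun y => sumDiff n p.1.1 p.1.2 (t, y) = 0).card) :=
        Nat.mul_le_mul_left _ ((Finset.card_le_card hsub).trans ((Finset.card_union_le _ _).trans
          (Nat.add_le_add_left Finset.card_biUnion_le _)))
    _ ≤ _ := by
        rw [mul_add, Finset.mul_sum]
        refine Nat.add_le_add_left ?_ _
        rw [← smul_eq_mul (Fintype.card _), ← Finset.card_univ]
        refine Finset.sum_le_card_nsmul _ _ _ fun p _ => mul_card_zeros_le n
          (sumDiff_ne_zero n (p.1.1.2.trans p.1.2.2.symm) fun e => p.2 (Subtype.ext e)) ht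

end Rulers

/-- A polynomial which is `O(t ^ (n - 1))` along a residue class has degree less than `n`. -/
theorem degree_lt_of_abs_mul_eval_le {q : Polynomial ℚ} {n s i : ℕ} (hs : 0 < s) {K : ℚ}
    (h : ∀ t : ℕ, 0 < t → t % s = i % s → |(t : ℚ) * q.eval (t : ℚ)| ≤ K * (t : ℚ) ^ n) :
    q.degree < n := by
  by_contra! hq
  have hq0 : q ≠ 0 := by
    rintro rfl
    simp at hq
  have hdeg : (Polynomial.X ^ n : Polynomial ℚ).degree < (Polynomial.X * q).degree := by
    rw [Polynomial.degree_X_pow, Polynomial.degree_mul, Polynomial.degree_X,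
      Polynomial.degree_eq_natDegree hq0]
    rw [Polynomial.degree_eq_natDegree hq0] at hq
    have : n ≤ q.natDegree := by exact_mod_cast hq
    exact_mod_cast (by omega : n < 1 + q.natDegree)
  have hlim := Polynomial.abs_div_tendsto_atTop_atTop_of_degree_gt _ _ hdeg
    (pow_ne_zero n Polynomial.X_ne_zero)
  have hseq : Filter.Tendsto (fun j : ℕ => ((i + s * (j + 1) : ℕ) : ℚ)) Filter.atTop
      Filter.atTop := by
    refine tendsto_natCast_atTop_atTop.comp (Filter.tendsto_atTop_mono (fun j => ?_)
      Filter.tendsto_id)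
    simp only [id]
    nlinarith
  obtain ⟨j, hj⟩ := ((hlim.comp hseq).eventually_gt_atTop K).exists
  have ht : 0 < i + s * (j + 1) := by positivity
  have hb := h (i + s * (j + 1)) ht (by simp)
  have ht' : (0 : ℚ) < ((i + s * (j + 1) : ℕ) : ℚ) ^ n := by positivity
  simp only [Function.comp_apply, Polynomial.eval_mul, Polynomial.eval_X,
    Polynomial.eval_pow] at hj
  rw [abs_div, abs_of_pos ht', lt_div_iff₀ ht'] at hj
  exact absurd hb hj.not_ge

/-- The polynomial whose value at a positive integer `t` is `(t - 1).choose n`. -/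
noncomputable def predChoosePoly (n : ℕ) : Polynomial ℚ :=
  Polynomial.C (1 / (n.factorial : ℚ)) *
    (descPochhammer ℚ n).comp (Polynomial.X - Polynomial.C 1)

theorem predChoosePoly_eval (n : ℕ) {t : ℕ} (ht : 0 < t) :
    (predChoosePoly n).eval (t : ℚ) = (t - 1).choose n := by
  have h : (t : ℚ) - 1 = ((t - 1 : ℕ) : ℚ) := by
    rw [Nat.cast_sub ht, Nat.cast_one]
  have hn : (n.factorial : ℚ) ≠ 0 := by positivity
  simp only [predChoosePoly, Polynomial.eval_mul, Polynomial.eval_C, Polynomial.eval_comp,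
    Polynomial.eval_sub, Polynomial.eval_X]
  rw [h, descPochhammer_eval_eq_descFactorial, Nat.descFactorial_eq_factorial_mul_choose]
  push_cast
  field_simp

theorem predChoosePoly_natDegree (n : ℕ) : (predChoosePoly n).natDegree = n := by
  rw [predChoosePoly, Polynomial.natDegree_C_mul (by positivity), Polynomial.natDegree_comp,
    descPochhammer_natDegree, Polynomial.natDegree_X_sub_C, mul_one]

theorem predChoosePoly_leadingCoeff (n : ℕ) :
    (predChoosePoly n).leadingCoeff = 1 / (n.factorial : ℚ) := by
  rw [predChoosePoly, Polynomial.leadingCoeff_mul, Polynomial.leadingCoeff_C,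
    ((monic_descPochhammer ℚ n).comp_X_sub_C 1).leadingCoeff, mul_one]

/-- `b_{m,h}` is a quasipolynomial in `t` of degree `m-1` with leading coefficient
`1/(m-1)!`. -/
theorem bmh_quasipolynomial (m h : ℕ) (hm : 1 ≤ m) (hh : 2 ≤ h) :
    ∃ s : ℕ, 0 < s ∧ ∃ p : ℕ → Polynomial ℚ,
      (∀ i < s, (p i).natDegree = m - 1 ∧
        (p i).leadingCoeff = 1 / (Nat.factorial (m - 1) : ℚ)) ∧
      ∀ t : ℕ, 0 < t → (bmh m h (t : ℤ) : ℚ) = (p (t % s)).eval (t : ℚ) := by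
  obtain ⟨n, rfl⟩ := Nat.exists_eq_add_of_le' hm
  obtain ⟨s, hs, p, hp⟩ := exists_eval_eq_bmh n h
  obtain ⟨K, hK⟩ := bmh_bounds n h
  refine ⟨s, hs, p, fun i hi => ?_, hp⟩
  have hlt : (p i - predChoosePoly n).degree < n := by
    refine degree_lt_of_abs_mul_eval_le (i := i) (K := K) hs fun t ht hti => ?_
    rw [Nat.mod_eq_of_lt hi] at hti
    obtain ⟨h1, h2⟩ := hK t ht
    have h1' : (bmh (n + 1) h t : ℚ) ≤ (t - 1).choose n := by exact_mod_cast h1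
    have h2' : (t : ℚ) * (t - 1).choose n ≤ t * bmh (n + 1) h t + K * (t : ℚ) ^ n := by
      exact_mod_cast h2
    have h0 : (0 : ℚ) ≤ K * (t : ℚ) ^ n := by positivity
    have ht' : (0 : ℚ) ≤ t := by positivity
    rw [Polynomial.eval_sub, predChoosePoly_eval n ht, ← hti, ← hp t ht, abs_le]
    constructor <;> nlinarith
  have hne : predChoosePoly n ≠ 0 := by
    rw [← Polynomial.leadingCoeff_ne_zero, predChoosePoly_leadingCoeff]
    positivity
  have hdeg : (p i - predChoosePoly n).degree < (predChoosePoly n).degree := by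
    rwa [Polynomial.degree_eq_natDegree hne, predChoosePoly_natDegree]
  rw [← sub_add_cancel (p i) (predChoosePoly n), Nat.add_sub_cancel]
  exact ⟨by rw [Polynomial.natDegree_add_eq_right_of_degree_lt hdeg, predChoosePoly_natDegree],
    by rw [Polynomial.leadingCoeff_add_of_degree_lt hdeg, predChoosePoly_leadingCoeff]⟩
end

section
/- For every integer m ≥ 1 and every integer g ≥ 2, the counting function b_m[g](t) is a quasipolynomial in t of degree m−1 with leading coefficient 1/(m−1)!. -/
/-- A ruler is a `B_2[g]`-set if every integer has at most `g` representations as a sum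
`x i + x j` with `i ≤ j`. -/
def IsB2gSet (m g : ℕ) (x : Fin (m + 1) → ℤ) : Prop :=
  ∀ n : ℤ, {p : Fin (m + 1) × Fin (m + 1) | p.1 ≤ p.2 ∧ x p.1 + x p.2 = n}.ncard ≤ g

/-- `b_m[g](t)`: the number of `B_2[g]`-sets of length `t` with `m+1` markings. -/
noncomputable def bmg (m g : ℕ) (t : ℤ) : ℕ :=
  Nat.card {x : Fin (m + 1) → ℤ // IsRuler m t x ∧ IsB2gSet m g x}

section

open Polynomial

/-- Quasipolynomial functions of an integer variable. -/
def IsQuasipoly (q : ℤ → ℚ) : Prop :=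
  ∃ D : ℕ, 0 < D ∧ ∃ p : ℤ → ℚ[X], Function.Periodic p (D : ℤ) ∧ ∀ v, q v = (p v).eval (v : ℚ)

namespace IsQuasipoly

theorem of_periodic {φ : ℤ → ℚ} {D : ℕ} (hD : 0 < D) (h : Function.Periodic φ (D : ℤ)) :
    IsQuasipoly φ :=
  ⟨D, hD, fun v => C (φ v), fun v => by simp [h v], by simp⟩

theorem const (c : ℚ) : IsQuasipoly fun _ => c :=
  of_periodic one_pos fun _ => rfl

theorem intCast : IsQuasipoly fun v => (v : ℚ) :=
  ⟨1, one_pos, fun _ => X, fun _ => rfl, by simp⟩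

theorem add {q r : ℤ → ℚ} (hq : IsQuasipoly q) (hr : IsQuasipoly r) : IsQuasipoly (q + r) := by
  obtain ⟨D, hD, p, hp, h⟩ := hq
  obtain ⟨E, hE, p', hp', h'⟩ := hr
  refine ⟨D * E, by positivity, p + p', ?_, fun v => by simp [h, h']⟩
  push_cast
  have h1 := hp.int_mul E
  have h2 := hp'.int_mul D
  rw [mul_comm] at h1
  exact Function.Periodic.add (by simpa [mul_comm] using h1) (by simpa using h2)

theorem mul {q r : ℤ → ℚ} (hq : IsQuasipoly q) (hr : IsQuasipoly r) : IsQuasipoly (q * r) := by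
  obtain ⟨D, hD, p, hp, h⟩ := hq
  obtain ⟨E, hE, p', hp', h'⟩ := hr
  refine ⟨D * E, by positivity, p * p', ?_, fun v => by simp [h, h']⟩
  push_cast
  have h1 := hp.int_mul E
  have h2 := hp'.int_mul D
  exact Function.Periodic.mul (by simpa [mul_comm] using h1) (by simpa using h2)

theorem sum {ι : Type*} (s : Finset ι) {q : ι → ℤ → ℚ} (h : ∀ i ∈ s, IsQuasipoly (q i)) :
    IsQuasipoly (∑ i ∈ s, q i) := by
  induction s using Finset.cons_induction with
  | empty => exact const 0
  | cons a s ha ih =>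
    rw [Finset.sum_cons]
    exact (h a (by simp)).add (ih fun i hi => h i (by simp [hi]))

theorem shift {q : ℤ → ℚ} (hq : IsQuasipoly q) (j : ℤ) : IsQuasipoly fun v => q (v + j) := by
  obtain ⟨D, hD, p, hp, h⟩ := hq
  refine ⟨D, hD, fun v => (p (v + j)).comp (X + C (j : ℚ)), fun v => ?_, fun v => by simp [h]⟩
  simp only
  rw [add_right_comm, hp]

end IsQuasipoly

theorem Polynomial.exists_antidifference (D : ℚ) (hD : D ≠ 0) (p : ℚ[X]) :
    ∃ P : ℚ[X], ∀ x, P.eval (x + D) - P.eval x = p.eval x := by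
  induction p using Polynomial.induction_on' with
  | add p q hp hq =>
    obtain ⟨P, hP⟩ := hp
    obtain ⟨Q, hQ⟩ := hq
    refine ⟨P + Q, fun x => ?_⟩
    simp only [eval_add, ← hP, ← hQ]
    ring
  | monomial n a =>
    refine ⟨C (a * D ^ n / (n + 1)) * (Polynomial.bernoulli (n + 1)).comp (C D⁻¹ * X), fun x => ?_⟩
    have h : D⁻¹ * (x + D) = 1 + D⁻¹ * x := by field_simp; ring
    have hn : (n : ℚ) + 1 ≠ 0 := by positivity
    simp only [eval_mul, eval_C, eval_comp, eval_X, h, bernoulli_eval_one_add, eval_monomial]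
    push_cast
    simp only [mul_pow, inv_pow]
    field_simp
    ring

theorem IsQuasipoly.exists_antidifference {q : ℤ → ℚ} (hq : IsQuasipoly q) :
    ∃ Q, IsQuasipoly Q ∧ ∀ v, Q (v + 1) - Q v = q v := by
  obtain ⟨D, hD, p, hp, h⟩ := hq
  choose F hF using Polynomial.exists_antidifference (D : ℚ) (by positivity)
  have hK : IsQuasipoly fun v : ℤ => (F (p v)).eval (v : ℚ) :=
    ⟨D, hD, fun v => F (p v), fun v => by simp only [hp v], fun _ => rfl⟩
  refine ⟨_, IsQuasipoly.sum (Finset.range D) fun j _ => hK.shift j, fun v => ?_⟩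
  simp only [Finset.sum_apply]
  have := Finset.sum_range_sub (fun j : ℕ => (F (p (v + j))).eval (((v + j : ℤ)) : ℚ)) D
  rw [← Finset.sum_sub_distrib, h, ← hF (p v) v]
  simp only [hp v, Nat.cast_zero, add_zero] at this
  push_cast at this ⊢
  rw [← this]
  refine Finset.sum_congr rfl fun j _ => ?_
  rw [show v + 1 + (j : ℤ) = v + (j + 1) by ring, show (v : ℚ) + 1 + j = v + (j + 1) by ring]

/-- The generators of `piecewiseQuasipoly`. -/
inductive PiecewiseGen (M : Type) [AddCommGroup M] : (M → ℚ) → Prop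
  | linear (L : M →+ ℤ) : PiecewiseGen M fun x => (L x : ℚ)
  | pos (L : M →+ ℤ) : PiecewiseGen M fun x => if 0 < L x then 1 else 0
  | periodic (L : M →+ ℤ) (φ : ℤ → ℚ) (D : ℕ) (hD : 0 < D) (hφ : Function.Periodic φ (D : ℤ)) :
      PiecewiseGen M fun x => φ (L x)

/-- The functions that are quasipolynomial on each cone of some finite arrangement of
hyperplanes through the origin. -/
def piecewiseQuasipoly (M : Type) [AddCommGroup M] : Subalgebra ℚ (M → ℚ) :=
  Algebra.adjoin ℚ {f | PiecewiseGen M f}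

section

variable {M N : Type} [AddCommGroup M] [AddCommGroup N]

local notation "𝓐" => piecewiseQuasipoly

theorem linear_mem (L : M →+ ℤ) : (fun x => (L x : ℚ)) ∈ 𝓐 M :=
  Algebra.subset_adjoin (.linear L)

theorem pos_mem (L : M →+ ℤ) : (fun x => if 0 < L x then (1 : ℚ) else 0) ∈ 𝓐 M :=
  Algebra.subset_adjoin (.pos L)

theorem periodic_mem (L : M →+ ℤ) {φ : ℤ → ℚ} {D : ℕ} (hD : 0 < D)
    (hφ : Function.Periodic φ (D : ℤ)) : (fun x => φ (L x)) ∈ 𝓐 M :=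
  Algebra.subset_adjoin (.periodic L φ D hD hφ)

theorem const_mem (c : ℚ) : (fun _ => c) ∈ 𝓐 M :=
  (𝓐 M).algebraMap_mem c

theorem comp_mem (g : N →+ M) {f : M → ℚ} (hf : f ∈ 𝓐 M) : (fun x => f (g x)) ∈ 𝓐 N := by
  induction hf using Algebra.adjoin_induction with
  | mem f hf =>
    cases hf with
    | linear L => exact linear_mem (L.comp g)
    | pos L => exact pos_mem (L.comp g)
    | periodic L φ D hD hφ => exact periodic_mem (L.comp g) hD hφ
  | algebraMap r => exact const_mem r
  | add f h _ _ hf hh => exact add_mem hf hh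
  | mul f h _ _ hf hh => exact mul_mem hf hh

theorem eval_mem (p : ℚ[X]) {f : M → ℚ} (hf : f ∈ 𝓐 M) : (fun x => p.eval (f x)) ∈ 𝓐 M := by
  induction p using Polynomial.induction_on' with
  | add p q hp hq =>
    simp only [eval_add]
    exact add_mem hp hq
  | monomial n a =>
    simp only [eval_monomial]
    exact mul_mem (const_mem a) (pow_mem hf n)

/-- Quasipolynomials of rounded linear forms are piecewise quasipolynomial. -/
theorem ediv_mem (L : M →+ ℤ) {c : ℤ} (hc : 0 < c) (d e : ℤ) {q : ℤ → ℚ} (hq : IsQuasipoly q) :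
    (fun x => q ((L x + d) / c + e)) ∈ 𝓐 M := by
  obtain ⟨D, hD, p, hp, h⟩ := hq
  have hfl : (fun x => (((L x + d) / c + e : ℤ) : ℚ)) ∈ 𝓐 M := by
    have h1 : (fun x => (((L x + d) % c : ℤ) : ℚ)) ∈ 𝓐 M := by
      refine periodic_mem L (φ := fun y => (((y + d) % c : ℤ) : ℚ)) (D := c.toNat) (by omega) ?_
      intro y
      simp only [Int.toNat_of_nonneg hc.le]
      rw [add_right_comm, Int.add_emod_right]
    have h2 := add_mem (mul_mem (const_mem (M := M) (1 / (c : ℚ)))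
      (add_mem (linear_mem L) (sub_mem (const_mem (d : ℚ)) h1))) (const_mem (e : ℚ))
    convert h2 using 1
    funext x
    simp only [Pi.add_apply, Pi.mul_apply, Pi.sub_apply]
    have h3 := Int.mul_ediv_add_emod (L x + d) c
    have h4 : (c : ℚ) * ((L x + d) / c : ℤ) + ((L x + d) % c : ℤ) = L x + d := by
      exact_mod_cast h3
    have : (c : ℚ) ≠ 0 := by exact_mod_cast hc.ne'
    push_cast
    field_simp
    linarith
  have hsum : (fun x => q ((L x + d) / c + e)) = ∑ r ∈ Finset.range D, fun x =>
      (if ((L x + d) / c + e) % D = r then (1 : ℚ) else 0) *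
        (p r).eval (((L x + d) / c + e : ℤ) : ℚ) := by
    funext x
    simp only [Finset.sum_apply, h]
    generalize (L x + d) / c + e = y
    have hD' : (0 : ℤ) < D := by exact_mod_cast hD
    have hn := Int.emod_nonneg y hD'.ne'
    have hl := Int.emod_lt_of_pos y hD'
    rw [Finset.sum_eq_single (y % D).toNat]
    · rw [if_pos (by omega), one_mul, Int.toNat_of_nonneg hn]
      congr 1
      have := (hp.int_mul (y / D)) (y % D)
      rw [← this]
      congr 1
      have := Int.mul_ediv_add_emod y D
      simp only [Int.cast_id]
      linarith
    · intro b _ hb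
      rw [if_neg (by omega), zero_mul]
    · intro hb
      simp only [Finset.mem_range] at hb
      omega
  rw [hsum]
  refine sum_mem fun r _ => mul_mem ?_ (eval_mem _ hfl)
  refine periodic_mem L (φ := fun y => if ((y + d) / c + e) % D = r then (1 : ℚ) else 0)
    (D := c.toNat * D) (Nat.mul_pos (by omega) hD) ?_
  intro y
  push_cast
  rw [Int.toNat_of_nonneg hc.le]
  have : (y + c * D + d) / c + e = ((y + d) / c + e) + D := by
    rw [add_right_comm, Int.add_mul_ediv_left _ _ hc.ne']
    ring
  simp only [this, Int.add_emod_right]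

/-- Indicators of half-lines `L x < c v + δ` in the variable `v`. -/
inductive IsThreshold : (M × ℤ → ℚ) → Prop
  | one : IsThreshold fun _ => 1
  | lt (L : M →+ ℤ) (c : ℤ) (hc : 0 < c) (δ : ℤ) (hδ : δ = 0 ∨ δ = 1) :
      IsThreshold fun p => if L p.1 < c * p.2 + δ then 1 else 0

theorem threshold_mul_of_le (L L' : M →+ ℤ) {c c' δ δ' : ℤ} (hc : 0 < c) (hc' : 0 < c')
    (hδ : δ = 0 ∨ δ = 1) (hδ' : δ' = 0 ∨ δ' = 1) (h : δ ≤ δ') :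
    ∃ b ∈ 𝓐 M, ∀ p : M × ℤ,
      (if L p.1 < c * p.2 + δ then (1 : ℚ) else 0) * (if L' p.1 < c' * p.2 + δ' then 1 else 0) =
        b p.1 * (if L p.1 < c * p.2 + δ then 1 else 0) +
          (1 - b p.1) * (if L' p.1 < c' * p.2 + δ' then 1 else 0) := by
  refine ⟨_, sub_mem (const_mem 1) (pos_mem (c • L' - c' • L)), fun ⟨x, v⟩ => ?_⟩
  simp only [Pi.sub_apply, AddMonoidHom.sub_apply, AddMonoidHom.smul_apply, smul_eq_mul, sub_pos]
  by_cases hcmp : c' * L x < c * L' x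
  · have : L' x < c' * v + δ' → L x < c * v + δ := by
      intro h1
      have h2 : L' x ≤ c' * v := by omega
      have h3 : L x < c * v := by nlinarith
      omega
    by_cases h1 : L' x < c' * v + δ'
    · simp [hcmp, h1, this h1]
    · simp [hcmp, h1]
  · have : L x < c * v + δ → L' x < c' * v + δ' := by
      intro h1
      obtain rfl | rfl := hδ
      · have : L' x < c' * v := by nlinarith
        omega
      · have h2 : L x ≤ c * v := by omega
        have : L' x ≤ c' * v := by nlinarith
        omega
    by_cases h1 : L x < c * v + δ
    · simp [hcmp, h1, this h1]
    · simp [hcmp, h1]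

theorem IsThreshold.exists_mul_eq {θ θ' : M × ℤ → ℚ} (h : IsThreshold θ) (h' : IsThreshold θ') :
    ∃ b ∈ 𝓐 M, ∀ p, θ p * θ' p = b p.1 * θ p + (1 - b p.1) * θ' p := by
  cases h with
  | one => exact ⟨_, const_mem 0, fun p => by simp⟩
  | lt L c hc δ hδ =>
    cases h' with
    | one => exact ⟨_, const_mem 1, fun p => by simp⟩
    | lt L' c' hc' δ' hδ' =>
      rcases le_total δ δ' with hle | hle
      · exact threshold_mul_of_le L L' hc hc' hδ hδ' hle
      · obtain ⟨b, hb, h⟩ := threshold_mul_of_le L' L hc' hc hδ' hδ hle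
        refine ⟨_, sub_mem (const_mem 1) hb, fun p => ?_⟩
        rw [mul_comm, h p]
        simp only [Pi.sub_apply]
        ring

theorem quasipoly_snd_mem {q : ℤ → ℚ} (hq : IsQuasipoly q) :
    (fun p : M × ℤ => q p.2) ∈ 𝓐 (M × ℤ) := by
  simpa using ediv_mem (AddMonoidHom.snd M ℤ) one_pos 0 0 hq

theorem IsThreshold.exists_antidifference {θ : M × ℤ → ℚ} (h : IsThreshold θ) {q : ℤ → ℚ}
    (hq : IsQuasipoly q) :
    ∃ G ∈ 𝓐 (M × ℤ), ∀ x v, G (x, v + 1) - G (x, v) = q v * θ (x, v) := by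
  obtain ⟨Q, hQ, hQq⟩ := hq.exists_antidifference
  cases h with
  | one => exact ⟨_, quasipoly_snd_mem hQ, fun x v => by simp [hQq]⟩
  | lt L c hc δ hδ =>
    have hθ : (fun p : M × ℤ => if L p.1 < c * p.2 + δ then (1 : ℚ) else 0) ∈ 𝓐 (M × ℤ) := by
      obtain rfl | rfl := hδ
      · convert pos_mem (c • AddMonoidHom.snd M ℤ - L.comp (AddMonoidHom.fst M ℤ)) using 1
        funext p
        simp only [AddMonoidHom.sub_apply, AddMonoidHom.smul_apply, smul_eq_mul, sub_pos,
          AddMonoidHom.comp_apply, AddMonoidHom.coe_fst, AddMonoidHom.coe_snd, add_zero]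
      · convert sub_mem (const_mem 1)
          (pos_mem (L.comp (AddMonoidHom.fst M ℤ) - c • AddMonoidHom.snd M ℤ)) using 1
        funext p
        simp only [Pi.sub_apply, AddMonoidHom.sub_apply, AddMonoidHom.smul_apply, smul_eq_mul,
          sub_pos, AddMonoidHom.comp_apply, AddMonoidHom.coe_fst, AddMonoidHom.coe_snd,
          Int.lt_add_one_iff]
        split_ifs <;> first | omega | simp
    refine ⟨_, mul_mem hθ (sub_mem (quasipoly_snd_mem hQ)
      (comp_mem (AddMonoidHom.fst M ℤ) (ediv_mem L hc (-δ) 1 hQ))), fun x v => ?_⟩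
    simp only [Pi.mul_apply, Pi.sub_apply, AddMonoidHom.coe_fst]
    have hiff : ∀ w, L x < c * w + δ ↔ (L x + -δ) / c + 1 ≤ w := by
      intro w
      rw [Int.add_one_le_iff, Int.ediv_lt_iff_lt_mul hc, mul_comm w]
      constructor <;> intro <;> linarith
    simp only [hiff]
    generalize (L x + -δ) / c + 1 = τ
    rcases lt_trichotomy (v + 1) τ with h | h | h
    · rw [if_neg (by omega), if_neg (by omega)]; simp
    · subst h; simp
    · rw [if_pos (by omega), if_pos (by omega), ← hQq]; ring

/-- Combinations of thresholds and quasipolynomials in the second variable, with coefficients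
depending on the first variable. -/
def thresholdSpan (M : Type) [AddCommGroup M] : Submodule ℚ (M × ℤ → ℚ) :=
  Submodule.span ℚ {f | ∃ b ∈ 𝓐 M, ∃ q, IsQuasipoly q ∧ ∃ θ, IsThreshold θ ∧
    f = fun p => b p.1 * q p.2 * θ p}

theorem mem_thresholdSpan {b : M → ℚ} (hb : b ∈ 𝓐 M) {q : ℤ → ℚ} (hq : IsQuasipoly q)
    {θ : M × ℤ → ℚ} (hθ : IsThreshold θ) :
    (fun p : M × ℤ => b p.1 * q p.2 * θ p) ∈ thresholdSpan M :=
  Submodule.subset_span ⟨b, hb, q, hq, θ, hθ, rfl⟩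

theorem fst_mem_thresholdSpan {b : M → ℚ} (hb : b ∈ 𝓐 M) :
    (fun p : M × ℤ => b p.1) ∈ thresholdSpan M := by
  simpa using mem_thresholdSpan hb (.const 1) .one

theorem thresholdSpan_mul_mem {f f' : M × ℤ → ℚ} (hf : f ∈ thresholdSpan M)
    (hf' : f' ∈ thresholdSpan M) : f * f' ∈ thresholdSpan M := by
  have key : thresholdSpan M * thresholdSpan M ≤ thresholdSpan M := by
    conv_lhs => rw [thresholdSpan, Submodule.span_mul_span]
    rw [Submodule.span_le]
    rintro _ ⟨_, ⟨b, hb, q, hq, θ, hθ, rfl⟩, _, ⟨b', hb', q', hq', θ', hθ', rfl⟩, rfl⟩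
    obtain ⟨a, ha, h⟩ := hθ.exists_mul_eq hθ'
    have h1 := mem_thresholdSpan (mul_mem (mul_mem hb hb') ha) (hq.mul hq') hθ
    have h2 := mem_thresholdSpan (mul_mem (mul_mem hb hb') (sub_mem (const_mem 1) ha))
      (hq.mul hq') hθ'
    refine (congrArg (· ∈ thresholdSpan M) (funext fun p => ?_)).mp (add_mem h1 h2)
    simp only [Pi.mul_apply, Pi.add_apply, Pi.sub_apply]
    linear_combination -(b p.1 * b' p.1 * q p.2 * q' p.2 * h p)
  exact key (Submodule.mul_mem_mul hf hf')

theorem piecewiseGen_mem_thresholdSpan {f : M × ℤ → ℚ} (hf : PiecewiseGen (M × ℤ) f) :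
    f ∈ thresholdSpan M := by
  have split : ∀ (L : M × ℤ →+ ℤ) (p : M × ℤ),
      L p = L.comp (AddMonoidHom.inl M ℤ) p.1 + L (0, 1) * p.2 := by
    rintro L ⟨x, v⟩
    have h1 : ((x, v) : M × ℤ) = (x, 0) + v • (0, 1) := by simp
    rw [h1, map_add, map_zsmul]
    simp [mul_comm]
  cases hf with
  | linear L =>
    have h1 := fst_mem_thresholdSpan (linear_mem (L.comp (AddMonoidHom.inl M ℤ)))
    have h2 := mem_thresholdSpan (const_mem (M := M) (L (0, 1) : ℚ)) .intCast .one
    convert add_mem h1 h2 using 1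
    funext p
    rw [split]
    simp
  | pos L =>
    have hs := split L
    generalize L.comp (AddMonoidHom.inl M ℤ) = L' at hs
    generalize L (0, 1) = c at hs
    simp only [hs]
    rcases lt_trichotomy c 0 with hc | rfl | hc
    · have h1 := mem_thresholdSpan (const_mem (M := M) 1) (.const 1)
        (.lt L' (-c) (by omega) 1 (.inr rfl))
      convert sub_mem (fst_mem_thresholdSpan (const_mem 1)) h1 using 1
      funext p
      simp only [Pi.sub_apply, one_mul, neg_mul, Int.lt_add_one_iff]
      split_ifs <;> first | omega | simp
    · simpa using fst_mem_thresholdSpan (pos_mem L')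
    · have h1 := mem_thresholdSpan (const_mem (M := M) 1) (.const 1)
        (.lt (-L') c hc 0 (.inl rfl))
      convert h1 using 1
      funext p
      simp only [one_mul, add_zero, AddMonoidHom.neg_apply]
      split_ifs <;> first | omega | simp
  | periodic L φ D hD hφ =>
    have hs := split L
    generalize L.comp (AddMonoidHom.inl M ℤ) = L' at hs
    generalize L (0, 1) = c at hs
    have hD' : (0 : ℤ) < D := by exact_mod_cast hD
    have hsum : (fun p => φ (L p)) = ∑ r ∈ Finset.range D, fun p : M × ℤ =>
        (if L' p.1 % D = r then (1 : ℚ) else 0) * φ (r + c * p.2) * 1 := by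
      funext p
      simp only [Finset.sum_apply, hs]
      generalize L' p.1 = y
      have hn := Int.emod_nonneg y hD'.ne'
      have hl := Int.emod_lt_of_pos y hD'
      rw [Finset.sum_eq_single (y % D).toNat]
      · rw [if_pos (by omega), one_mul, Int.toNat_of_nonneg hn, mul_one]
        rw [← (hφ.int_mul (y / D)) (y % D + c * p.2)]
        congr 1
        have := Int.mul_ediv_add_emod y D
        simp only [Int.cast_id]
        linarith
      · intro b _ hb
        rw [if_neg (by omega)]
        simp
      · intro hb
        simp only [Finset.mem_range] at hb
        omega
    rw [hsum]
    refine sum_mem fun r _ => mem_thresholdSpan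
      (periodic_mem L' (φ := fun y => if y % D = r then (1 : ℚ) else 0) hD fun y => ?_)
      (q := fun v => φ (r + c * v)) (.of_periodic hD fun v => ?_) .one
    · simp only [Int.add_emod_right]
    · rw [← (hφ.int_mul c) (r + c * v)]
      congr 1
      simp only [Int.cast_id]
      ring

theorem mem_thresholdSpan_of_mem {f : M × ℤ → ℚ} (hf : f ∈ 𝓐 (M × ℤ)) : f ∈ thresholdSpan M := by
  induction hf using Algebra.adjoin_induction with
  | mem f hf => exact piecewiseGen_mem_thresholdSpan hf
  | algebraMap r => exact fst_mem_thresholdSpan (const_mem r)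
  | add f h _ _ hf hh => exact add_mem hf hh
  | mul f h _ _ hf hh => exact thresholdSpan_mul_mem hf hh

theorem exists_antidifference_mem {f : M × ℤ → ℚ} (hf : f ∈ 𝓐 (M × ℤ)) :
    ∃ G ∈ 𝓐 (M × ℤ), ∀ x v, G (x, v + 1) - G (x, v) = f (x, v) := by
  have hf' := mem_thresholdSpan_of_mem hf
  clear hf
  induction hf' using Submodule.span_induction with
  | mem f hf =>
    obtain ⟨b, hb, q, hq, θ, hθ, rfl⟩ := hf
    obtain ⟨G, hG, h⟩ := hθ.exists_antidifference hq
    refine ⟨_, mul_mem (comp_mem (AddMonoidHom.fst M ℤ) hb) hG, fun x v => ?_⟩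
    simp only [Pi.mul_apply, AddMonoidHom.coe_fst]
    linear_combination b x * h x v
  | zero => exact ⟨0, zero_mem _, fun x v => by simp⟩
  | add f f' _ _ hf hf' =>
    obtain ⟨G, hG, h⟩ := hf
    obtain ⟨G', hG', h'⟩ := hf'
    refine ⟨_, add_mem hG hG', fun x v => ?_⟩
    simp only [Pi.add_apply]
    linear_combination h x v + h' x v
  | smul a f _ hf =>
    obtain ⟨G, hG, h⟩ := hf
    refine ⟨_, (𝓐 (M × ℤ)).smul_mem hG a, fun x v => ?_⟩
    simp only [Pi.smul_apply, smul_eq_mul]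
    linear_combination a * h x v

/-- Summing over an interval with linear endpoint preserves piecewise quasipolynomiality. -/
theorem sum_Icc_mem {f : M × ℤ → ℚ} (hf : f ∈ 𝓐 (M × ℤ)) (L : M →+ ℤ) :
    (fun x => ∑ v ∈ Finset.Icc 0 (L x), f (x, v)) ∈ 𝓐 M := by
  obtain ⟨G, hG, h⟩ := exists_antidifference_mem hf
  have hL := comp_mem ((AddMonoidHom.id M).prod L) (add_mem hG hf)
  have h0 := comp_mem ((AddMonoidHom.id M).prod 0) hG
  convert mul_mem (sub_mem (const_mem 1) (pos_mem (-L))) (sub_mem hL h0) using 1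
  funext x
  suffices ∀ n : ℤ, ∑ v ∈ Finset.Icc 0 n, f (x, v) =
      (1 - if 0 < -n then 1 else 0) * (G (x, n) + f (x, n) - G (x, 0)) from this (L x)
  intro n
  by_cases hn : 0 ≤ n
  · rw [if_neg (by omega)]
    lift n to ℕ using hn
    induction n with
    | zero => simp
    | succ n ih =>
      rw [show (Finset.Icc (0 : ℤ) ((n + 1 : ℕ) : ℤ)) =
        insert ((n : ℤ) + 1) (Finset.Icc 0 (n : ℤ)) by ext; simp; omega,
        Finset.sum_insert (by simp), ih]
      push_cast
      linear_combination - h x n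
  · rw [Finset.Icc_eq_empty (by omega), if_pos (by omega)]
    simp

theorem sum_piFinset_mem (L : M →+ ℤ) (k : ℕ) {f : M × (Fin k → ℤ) → ℚ}
    (hf : f ∈ 𝓐 (M × (Fin k → ℤ))) :
    (fun x => ∑ v ∈ Fintype.piFinset fun _ => Finset.Icc 0 (L x), f (x, v)) ∈ 𝓐 M := by
  induction k with
  | zero =>
    convert comp_mem (AddMonoidHom.prod (AddMonoidHom.id M) 0) hf using 1
    funext x
    simp only [Fintype.piFinset_of_isEmpty, Finset.univ_unique, Finset.sum_singleton]
    exact congrArg f (Prod.ext rfl (Subsingleton.elim _ _))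
  | succ k ih =>
    let g : (M × (Fin k → ℤ)) × ℤ →+ M × (Fin (k + 1) → ℤ) :=
      { toFun := fun p => (p.1.1, Fin.cons p.2 p.1.2)
        map_zero' := by
          refine Prod.ext rfl (funext fun i => ?_)
          cases i using Fin.cases <;> rfl
        map_add' := fun p p' => by
          refine Prod.ext rfl (funext fun i => ?_)
          cases i using Fin.cases <;> rfl }
    have h := ih (sum_Icc_mem (comp_mem g hf) (L.comp (AddMonoidHom.fst M _)))
    convert h using 1
    funext x
    simp only [AddMonoidHom.comp_apply, AddMonoidHom.coe_fst]
    rw [Finset.sum_sigma']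
    refine Finset.sum_bij' (fun v _ => ⟨Fin.tail v, v 0⟩) (fun p _ => Fin.cons p.2 p.1)
      ?_ ?_ ?_ ?_ ?_
    · intro v hv
      simp only [Fintype.mem_piFinset, Finset.mem_sigma] at hv ⊢
      exact ⟨fun i => hv _, hv _⟩
    · intro p hp
      simp only [Fintype.mem_piFinset, Finset.mem_sigma] at hp ⊢
      intro i
      cases i using Fin.cases
      · exact hp.2
      · exact hp.1 _
    · intro v _
      exact Fin.cons_self_tail v
    · intro p _
      simp
    · intro v _
      change f (x, v) = f (x, Fin.cons (v 0) (Fin.tail v))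
      rw [Fin.cons_self_tail]

theorem exists_isQuasipoly_of_mem {f : ℤ → ℚ} (hf : f ∈ 𝓐 ℤ) :
    ∃ q, IsQuasipoly q ∧ ∀ t, 0 < t → f t = q t := by
  have lin : ∀ (L : ℤ →+ ℤ) (t : ℤ), L t = L 1 * t := fun L t => by
    conv_lhs => rw [← mul_one t, ← smul_eq_mul, map_zsmul, smul_eq_mul, mul_comm]
  induction hf using Algebra.adjoin_induction with
  | mem f hf =>
    cases hf with
    | linear L =>
      refine ⟨_, (IsQuasipoly.const (L 1)).mul .intCast, fun t _ => ?_⟩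
      simp only
      rw [lin L t]
      simp
    | pos L =>
      refine ⟨_, .const (if 0 < L 1 then 1 else 0), fun t ht => ?_⟩
      simp only
      rw [lin L t]
      simp [ht]
    | periodic L φ D hD hφ =>
      refine ⟨_, .of_periodic (φ := fun t => φ (L t)) hD fun t => ?_, fun t _ => rfl⟩
      simp only
      rw [lin L t, lin L (t + D), ← (hφ.int_mul (L 1)) (L 1 * t)]
      congr 1
      simp only [Int.cast_id]
      ring
  | algebraMap r => exact ⟨_, .const r, fun _ _ => rfl⟩
  | add f h _ _ hf hh =>
    obtain ⟨q, hq, h1⟩ := hf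
    obtain ⟨q', hq', h2⟩ := hh
    exact ⟨_, hq.add hq', fun t ht => by simp [h1 t ht, h2 t ht]⟩
  | mul f h _ _ hf hh =>
    obtain ⟨q, hq, h1⟩ := hf
    obtain ⟨q', hq', h2⟩ := hh
    exact ⟨_, hq.mul hq', fun t ht => by simp [h1 t ht, h2 t ht]⟩

end

/-! ### Indicators of constraints -/

section

variable {M : Type} [AddCommGroup M]

local notation "𝓐" => piecewiseQuasipoly

theorem indicator_not_mem {P : M → Prop} (h : {x | P x}.indicator (1 : M → ℚ) ∈ 𝓐 M) :
    {x | ¬P x}.indicator (1 : M → ℚ) ∈ 𝓐 M := by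
  change {x | P x}ᶜ.indicator 1 ∈ _
  rw [Set.indicator_compl]
  exact sub_mem (one_mem _) h

theorem indicator_and_mem {P Q : M → Prop} (hP : {x | P x}.indicator (1 : M → ℚ) ∈ 𝓐 M)
    (hQ : {x | Q x}.indicator (1 : M → ℚ) ∈ 𝓐 M) :
    {x | P x ∧ Q x}.indicator (1 : M → ℚ) ∈ 𝓐 M := by
  rw [Set.ofPred_and, Set.inter_indicator_one]
  exact mul_mem hP hQ

theorem indicator_imp_mem (p : Prop) {P : M → Prop}
    (hP : {x | P x}.indicator (1 : M → ℚ) ∈ 𝓐 M) :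
    {x | p → P x}.indicator (1 : M → ℚ) ∈ 𝓐 M := by
  by_cases hp : p
  · simpa [hp] using hP
  · simp [hp]

theorem indicator_forall_mem {ι : Type*} [Finite ι] {P : ι → M → Prop}
    (h : ∀ i, {x | P i x}.indicator (1 : M → ℚ) ∈ 𝓐 M) :
    {x | ∀ i, P i x}.indicator (1 : M → ℚ) ∈ 𝓐 M := by
  have key : ∀ s : Finset ι, {x | ∀ i ∈ s, P i x}.indicator (1 : M → ℚ) ∈ 𝓐 M := by
    intro s
    induction s using Finset.cons_induction with
    | empty => simp
    | cons a s ha ih =>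
      simp only [Finset.forall_mem_cons]
      exact indicator_and_mem (h a) ih
  have := Fintype.ofFinite ι
  simpa using key Finset.univ

theorem indicator_pos_mem (L : M →+ ℤ) : {x | 0 < L x}.indicator (1 : M → ℚ) ∈ 𝓐 M := by
  convert pos_mem L using 1
  funext x
  simp [Set.indicator_apply]

theorem indicator_eq_zero_mem (L : M →+ ℤ) : {x | L x = 0}.indicator (1 : M → ℚ) ∈ 𝓐 M := by
  convert indicator_and_mem (indicator_not_mem (indicator_pos_mem L))
    (indicator_not_mem (indicator_pos_mem (-L))) using 3
  ext x
  simp only [AddMonoidHom.neg_apply]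
  omega

end

theorem isB2gSet_iff (m g : ℕ) (x : Fin (m + 1) → ℤ) :
    IsB2gSet m g x ↔ ∀ T : Finset (Fin (m + 1) × Fin (m + 1)),
      (g < T.card ∧ ∀ p ∈ T, p.1 ≤ p.2) →
        ¬∀ r : (Fin (m + 1) × Fin (m + 1)) × (Fin (m + 1) × Fin (m + 1)),
          (r.1 ∈ T ∧ r.2 ∈ T) → x r.1.1 + x r.1.2 = x r.2.1 + x r.2.2 := by
  constructor
  · rintro h T ⟨hT, hle⟩ heq
    obtain ⟨p, hp⟩ := Finset.card_pos.mp (by omega : 0 < T.card)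
    have h1 := h (x p.1 + x p.2)
    have h2 : (T : Set _).ncard ≤ _ := Set.ncard_le_ncard
      (t := {q : Fin (m + 1) × Fin (m + 1) | q.1 ≤ q.2 ∧ x q.1 + x q.2 = x p.1 + x p.2})
      (fun q hq => ⟨hle q hq, heq (q, p) ⟨hq, hp⟩⟩) (Set.toFinite _)
    rw [Set.ncard_coe_finset] at h2
    omega
  · intro h n
    by_contra! hn
    have hfin : {p : Fin (m + 1) × Fin (m + 1) | p.1 ≤ p.2 ∧ x p.1 + x p.2 = n}.Finite :=
      Set.toFinite _
    refine h hfin.toFinset ⟨by rwa [← Set.ncard_eq_toFinset_card _ hfin], fun p hp => ?_⟩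
      fun r hr => ?_
    · exact (hfin.mem_toFinset.mp hp).1
    · rw [(hfin.mem_toFinset.mp hr.1).2, (hfin.mem_toFinset.mp hr.2).2]

theorem indicator_ruler_mem (m g : ℕ) :
    {p : ℤ × (Fin (m + 1) → ℤ) | IsRuler m p.1 p.2 ∧ IsB2gSet m g p.2}.indicator 1 ∈
      piecewiseQuasipoly (ℤ × (Fin (m + 1) → ℤ)) := by
  let c : Fin (m + 1) → (ℤ × (Fin (m + 1) → ℤ)) →+ ℤ := fun i =>
    (Pi.evalAddMonoidHom (fun _ => ℤ) i).comp (AddMonoidHom.snd ℤ _)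
  refine indicator_and_mem (indicator_and_mem ?_ (indicator_and_mem ?_ ?_)) ?_
  · refine indicator_forall_mem fun i => indicator_forall_mem fun j => indicator_imp_mem _ ?_
    convert indicator_pos_mem (c j - c i) using 3
    ext p
    simp [c]
  · exact indicator_eq_zero_mem (c 0)
  · convert indicator_eq_zero_mem (c (Fin.last m) - AddMonoidHom.fst ℤ _) using 3
    ext p
    simp [c, sub_eq_zero]
  · simp only [isB2gSet_iff]
    refine indicator_forall_mem fun T => indicator_imp_mem _ <| indicator_not_mem <|
      indicator_forall_mem fun r => indicator_imp_mem _ ?_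
    convert indicator_eq_zero_mem (c r.1.1 + c r.1.2 - (c r.2.1 + c r.2.2)) using 3
    ext p
    simp [c, sub_eq_zero]

open Classical in
/-- The finset of rulers of length `t` with `m + 1` markings. -/
noncomputable def rulers (m : ℕ) (t : ℤ) : Finset (Fin (m + 1) → ℤ) :=
  (Fintype.piFinset fun _ => Finset.Icc 0 t).filter (IsRuler m t)

theorem IsRuler.mem_Icc {m : ℕ} {t : ℤ} {x : Fin (m + 1) → ℤ} (h : IsRuler m t x)
    (i : Fin (m + 1)) : x i ∈ Finset.Icc 0 t := by
  obtain ⟨hx, h0, ht⟩ := h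
  rw [Finset.mem_Icc, ← h0, ← ht]
  exact ⟨hx.monotone (Fin.zero_le i), hx.monotone (Fin.le_last i)⟩

theorem mem_rulers {m : ℕ} {t : ℤ} {x : Fin (m + 1) → ℤ} : x ∈ rulers m t ↔ IsRuler m t x := by
  classical
  simp only [rulers, Finset.mem_filter, Fintype.mem_piFinset, and_iff_right_iff_imp]
  exact fun h i => h.mem_Icc i

open Classical in
theorem bmg_eq_card (m g : ℕ) (t : ℤ) :
    bmg m g t = ((rulers m t).filter (IsB2gSet m g)).card := by
  rw [bmg, Nat.subtype_card]
  simp [mem_rulers]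

theorem bmg_isQuasipoly (m g : ℕ) :
    ∃ q, IsQuasipoly q ∧ ∀ t : ℤ, 0 < t → (bmg m g t : ℚ) = q t := by
  classical
  refine exists_isQuasipoly_of_mem (f := fun t => (bmg m g t : ℚ)) ?_
  convert sum_piFinset_mem (AddMonoidHom.id ℤ) (m + 1) (indicator_ruler_mem m g) using 1
  funext t
  rw [bmg_eq_card, rulers, Finset.filter_filter, Finset.card_filter]
  push_cast
  refine Finset.sum_congr rfl fun x _ => ?_
  simp [Set.indicator_apply]

theorem card_rulers (k t : ℕ) (ht : 0 < t) :
    (rulers (k + 1) t).card = (t - 1).choose k := by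
  have hcard : ∀ s ∈ Finset.powersetCard k (Finset.Ioo (0 : ℤ) t),
      (insert 0 (insert (t : ℤ) s)).card = k + 1 + 1 := by
    intro s hs
    obtain ⟨hs, hk⟩ := Finset.mem_powersetCard.mp hs
    have h0 : (0 : ℤ) ∉ s := fun h => by simpa using hs h
    have h1 : (t : ℤ) ∉ s := fun h => by simpa using hs h
    rw [Finset.card_insert_of_notMem (by simp [h0]; omega), Finset.card_insert_of_notMem h1, hk]
  have : (Finset.powersetCard k (Finset.Ioo (0 : ℤ) t)).card = (t - 1).choose k := by
    simp
  rw [← this]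
  symm
  refine Finset.card_bij (fun s hs => (insert 0 (insert (t : ℤ) s)).orderEmbOfFin (hcard s hs))
    ?_ ?_ ?_
  · intro s hs
    have hs' := (Finset.mem_powersetCard.mp hs).1
    have hb : ∀ a ∈ s, 0 < a ∧ a < t := fun a ha => by simpa using hs' ha
    rw [mem_rulers]
    refine ⟨OrderEmbedding.strictMono _, ?_, ?_⟩
    · refine (Finset.orderEmbOfFin_zero (hcard s hs) (by omega)).trans ?_
      refine (Finset.min'_eq_iff _ _ _).mpr ⟨by simp, fun b hb' => ?_⟩
      simp only [Finset.mem_insert] at hb'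
      rcases hb' with rfl | rfl | h
      · rfl
      · omega
      · exact (hb b h).1.le
    · refine (Finset.orderEmbOfFin_last (hcard s hs) (by omega)).trans ?_
      refine (Finset.max'_eq_iff _ _ _).mpr ⟨by simp, fun b hb' => ?_⟩
      simp only [Finset.mem_insert] at hb'
      rcases hb' with rfl | rfl | h
      · omega
      · rfl
      · exact (hb b h).2.le
  · intro s hs s' hs' h
    have h1 := Finset.range_orderEmbOfFin _ (hcard s hs)
    rw [h, Finset.range_orderEmbOfFin _ (hcard s' hs'), Finset.coe_inj] at h1
    have hs := (Finset.mem_powersetCard.mp hs).1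
    have hs' := (Finset.mem_powersetCard.mp hs').1
    clear h hcard this
    ext a
    have h2 := Finset.ext_iff.mp h1 a
    simp only [Finset.mem_insert] at h2
    constructor
    · intro ha
      have := Finset.mem_Ioo.mp (hs ha)
      exact ((h2.mpr (.inr (.inr ha))).resolve_left (by omega)).resolve_left (by omega)
    · intro ha
      have := Finset.mem_Ioo.mp (hs' ha)
      exact ((h2.mp (.inr (.inr ha))).resolve_left (by omega)).resolve_left (by omega)
  · intro x hx
    rw [mem_rulers] at hx
    obtain ⟨hmono, h0, hl⟩ := id hx
    have himg : insert 0 (insert (t : ℤ) (((Finset.univ.image x).erase 0).erase t)) =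
        Finset.univ.image x := by
      ext a
      simp only [Finset.mem_insert, Finset.mem_erase, Finset.mem_image, Finset.mem_univ, true_and]
      constructor
      · rintro (rfl | rfl | h)
        · exact ⟨_, h0⟩
        · exact ⟨_, hl⟩
        · exact h.2.2
      · intro h
        by_cases h1 : a = 0
        · exact .inl h1
        by_cases h2 : a = t
        · exact .inr (.inl h2)
        exact .inr (.inr ⟨h2, h1, h⟩)
    have hmem : ((Finset.univ.image x).erase 0).erase (t : ℤ) ∈
        Finset.powersetCard k (Finset.Ioo (0 : ℤ) t) := by
      refine Finset.mem_powersetCard.mpr ⟨fun a ha => ?_, ?_⟩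
      · simp only [Finset.mem_erase, Finset.mem_image, Finset.mem_univ, true_and] at ha
        obtain ⟨h1, h2, i, rfl⟩ := ha
        have := Finset.mem_Icc.mp (hx.mem_Icc i)
        exact Finset.mem_Ioo.mpr ⟨by omega, by omega⟩
      · rw [Finset.card_erase_of_mem, Finset.card_erase_of_mem,
          Finset.card_image_of_injective _ hmono.injective]
        · simp
        · exact Finset.mem_image.mpr ⟨_, Finset.mem_univ _, h0⟩
        · exact Finset.mem_erase.mpr ⟨by omega, Finset.mem_image.mpr ⟨_, Finset.mem_univ _, hl⟩⟩
    refine ⟨_, hmem, ?_⟩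
    refine (Finset.orderEmbOfFin_unique (hcard _ hmem) (fun i => ?_) hmono).symm
    rw [himg]
    exact Finset.mem_image_of_mem _ (Finset.mem_univ _)

/-- Few rulers satisfy a given coincidence of nested sums. -/
theorem card_rulers_coincidence_le (k t : ℕ) {p₁ p₂ q₁ q₂ : Fin (k + 1 + 1)} (h1 : p₁ < q₁)
    (h2 : q₁ ≤ q₂) (h3 : q₂ < p₂) :
    ((rulers (k + 1) t).filter fun x => x p₁ + x p₂ = x q₁ + x q₂).card * (t + 1) ≤
      (t + 1) ^ k := by
  let J : Finset (Fin (k + 1 + 1)) := {0, Fin.last (k + 1), q₁}ᶜ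
  have hJ : J.card + 1 = k := by
    have h : ({0, Fin.last (k + 1), q₁} : Finset (Fin (k + 1 + 1))).card = 3 :=
      Finset.card_eq_three.mpr ⟨_, _, _, (Fin.last_pos).ne,
      ((Fin.zero_le p₁).trans_lt h1).ne,
      ((h2.trans_lt h3).trans_le (Fin.le_last p₂)).ne', rfl⟩
    have h' := Finset.card_add_card_compl ({0, Fin.last (k + 1), q₁} : Finset (Fin (k + 1 + 1)))
    rw [h, Fintype.card_fin] at h'
    change 3 + J.card = _ at h'
    omega
  have hle : ((rulers (k + 1) t).filter fun x => x p₁ + x p₂ = x q₁ + x q₂).card ≤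
      (Fintype.piFinset fun _ : J => Finset.Icc (0 : ℤ) t).card := by
    refine Finset.card_le_card_of_injOn (fun x i => x i) (fun x hx => ?_) fun x hx y hy hxy => ?_
    · simp only [Finset.coe_filter, Set.mem_ofPred_eq, mem_rulers] at hx
      exact Fintype.mem_piFinset.mpr fun i => hx.1.mem_Icc i
    · simp only [Finset.coe_filter, Set.mem_ofPred_eq, mem_rulers] at hx hy
      have hne : ∀ i, i ≠ q₁ → x i = y i := by
        intro i hi
        by_cases hi0 : i = 0
        · rw [hi0, hx.1.2.1, hy.1.2.1]
        by_cases hil : i = Fin.last (k + 1)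
        · rw [hil, hx.1.2.2, hy.1.2.2]
        exact congrFun hxy ⟨i, by simp [J, hi, hi0, hil]⟩
      have e1 := hne p₁ h1.ne
      have e2 := hne p₂ (h2.trans_lt h3).ne'
      funext i
      by_cases hi : i = q₁
      · subst hi
        by_cases hq : q₂ = i
        · subst hq
          omega
        · have := hne q₂ hq
          omega
      · exact hne i hi
  calc _ ≤ (t + 1) ^ J.card * (t + 1) := by
        refine Nat.mul_le_mul_right _ (hle.trans ?_)
        simp
    _ = (t + 1) ^ k := by rw [← pow_succ, hJ]

theorem IsRuler.exists_coincidence {m g : ℕ} (hg : 1 ≤ g) {t : ℤ} {x : Fin (m + 1) → ℤ}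
    (hx : IsRuler m t x) (hb : ¬IsB2gSet m g x) :
    ∃ p q : Fin (m + 1) × Fin (m + 1), (p.1 < q.1 ∧ q.1 ≤ q.2 ∧ q.2 < p.2) ∧
      x p.1 + x p.2 = x q.1 + x q.2 := by
  rw [isB2gSet_iff] at hb
  push Not at hb
  obtain ⟨T, ⟨hT, hle⟩, heq⟩ := hb
  obtain ⟨p, hp, q, hq, hpq⟩ := Finset.one_lt_card.mp (hg.trans_lt hT)
  have h := heq (p, q) ⟨hp, hq⟩
  simp only at h
  rcases lt_trichotomy p.1 q.1 with h1 | h1 | h1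
  · have := hx.1 h1
    exact ⟨p, q, ⟨h1, hle q hq, hx.1.lt_iff_lt.mp (by omega)⟩, h⟩
  · rw [h1] at h
    exact absurd (Prod.ext h1 (hx.1.injective (by omega))) hpq
  · have := hx.1 h1
    exact ⟨q, p, ⟨h1, hle p hp, hx.1.lt_iff_lt.mp (by omega)⟩, h.symm⟩

theorem bmg_add_error (k g : ℕ) (hg : 1 ≤ g) :
    ∃ N : ℕ, ∀ t : ℕ, 0 < t → ∃ e : ℕ, bmg (k + 1) g t + e = (t - 1).choose k ∧
      e * (t + 1) ≤ N * (t + 1) ^ k := by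
  classical
  let I := Finset.univ.filter fun r : (Fin (k + 1 + 1) × Fin (k + 1 + 1)) ×
    (Fin (k + 1 + 1) × Fin (k + 1 + 1)) => r.1.1 < r.2.1 ∧ r.2.1 ≤ r.2.2 ∧ r.2.2 < r.1.2
  refine ⟨I.card, fun t ht => ⟨((rulers (k + 1) t).filter fun x => ¬IsB2gSet (k + 1) g x).card,
    ?_, ?_⟩⟩
  · rw [bmg_eq_card, Finset.card_filter_add_card_filter_not, card_rulers k t ht]
  · have hsub : ((rulers (k + 1) t).filter fun x => ¬IsB2gSet (k + 1) g x) ⊆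
        I.biUnion fun r => (rulers (k + 1) t).filter fun x =>
          x r.1.1 + x r.1.2 = x r.2.1 + x r.2.2 := by
      intro x hx
      rw [Finset.mem_filter] at hx
      obtain ⟨p, q, h1, h2⟩ := (mem_rulers.mp hx.1).exists_coincidence hg hx.2
      exact Finset.mem_biUnion.mpr ⟨(p, q), by simpa [I] using h1,
        Finset.mem_filter.mpr ⟨hx.1, h2⟩⟩
    calc _ ≤ (∑ r ∈ I, ((rulers (k + 1) t).filter fun x =>
          x r.1.1 + x r.1.2 = x r.2.1 + x r.2.2).card) * (t + 1) :=
          Nat.mul_le_mul_right _ ((Finset.card_le_card hsub).trans Finset.card_biUnion_le)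
      _ ≤ ∑ r ∈ I, (t + 1) ^ k := by
          rw [Finset.sum_mul]
          refine Finset.sum_le_sum fun r hr => ?_
          obtain ⟨h1, h2, h3⟩ := (Finset.mem_filter.mp hr).2
          exact card_rulers_coincidence_le k t h1 h2 h3
      _ = I.card * (t + 1) ^ k := by simp

open Filter in
theorem Polynomial.degree_lt_of_bound (r : ℚ[X]) (d N : ℕ) (u : ℕ → ℕ) (hu : Tendsto u atTop atTop)
    (h : ∀ n, |r.eval (u n : ℚ)| * (u n + 1) ≤ N * ((u n : ℚ) + 1) ^ d) : r.degree < d := by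
  by_contra! hd
  have hdeg : ((X + 1 : ℚ[X]) ^ d).degree ≤ r.degree := by
    rw [degree_pow, ← C_1, degree_X_add_C]
    simpa using hd
  obtain ⟨c, hc, hO⟩ := (isBigO_atTop_of_degree_le _ _ hdeg).exists_pos
  have hu' : Tendsto (fun n => (u n : ℚ)) atTop atTop := tendsto_natCast_atTop_atTop.comp hu
  have h1 := hu'.eventually hO.bound
  obtain ⟨B, hB⟩ := exists_nat_gt ((c : ℝ) * N)
  obtain ⟨n, hn, hn'⟩ := (h1.and (hu.eventually_ge_atTop B)).exists
  have hnorm : ∀ a : ℚ, ‖a‖ = |(a : ℝ)| := fun a => rfl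
  simp only [hnorm, eval_pow, eval_add, eval_X, eval_one] at hn
  have hb : |((r.eval (u n : ℚ) : ℚ) : ℝ)| * (u n + 1) ≤ N * ((u n : ℝ) + 1) ^ d := by
    exact_mod_cast h n
  push_cast at hn
  rw [abs_of_nonneg (by positivity)] at hn
  have hpow : (0 : ℝ) < ((u n : ℝ) + 1) ^ d := by positivity
  have hBn : (B : ℝ) ≤ u n := by exact_mod_cast hn'
  have h2 : ((u n : ℝ) + 1) ^ d * (u n + 1) ≤ ((u n : ℝ) + 1) ^ d * (c * N) := by
    calc _ ≤ c * |((r.eval (u n : ℚ) : ℚ) : ℝ)| * (u n + 1) := by gcongr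
      _ = c * (|((r.eval (u n : ℚ) : ℚ) : ℝ)| * (u n + 1)) := by ring
      _ ≤ c * (N * ((u n : ℝ) + 1) ^ d) := by gcongr
      _ = _ := by ring
  have h3 := le_of_mul_le_mul_left h2 hpow
  linarith

/-- The polynomial whose value at `t ≥ 1` is `(t - 1).choose k`. -/
noncomputable def choosePoly (k : ℕ) : ℚ[X] :=
  C (1 / (k.factorial : ℚ)) * (descPochhammer ℚ k).comp (X - C 1)

theorem choosePoly_eval (k t : ℕ) (ht : 0 < t) :
    (choosePoly k).eval (t : ℚ) = (t - 1).choose k := by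
  obtain ⟨t, rfl⟩ := Nat.exists_eq_succ_of_ne_zero ht.ne'
  have : (k.factorial : ℚ) ≠ 0 := by exact_mod_cast k.factorial_ne_zero
  simp [choosePoly, descPochhammer_eval_eq_descFactorial, Nat.descFactorial_eq_factorial_mul_choose]
  field_simp

theorem choosePoly_natDegree (k : ℕ) : (choosePoly k).natDegree = k := by
  have : (k.factorial : ℚ) ≠ 0 := by exact_mod_cast k.factorial_ne_zero
  rw [choosePoly, natDegree_C_mul (by positivity), natDegree_comp, natDegree_X_sub_C,
    descPochhammer_natDegree, mul_one]

theorem choosePoly_leadingCoeff (k : ℕ) :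
    (choosePoly k).leadingCoeff = 1 / (k.factorial : ℚ) := by
  have h : ((descPochhammer ℚ k).comp (X - C 1)).Monic :=
    (monic_descPochhammer ℚ k).comp (monic_X_sub_C 1) (by
      rw [natDegree_X_sub_C]
      exact one_ne_zero)
  rw [choosePoly, leadingCoeff_mul, h.leadingCoeff, leadingCoeff_C, mul_one]

end

/-- `b_m[g]` is a quasipolynomial in `t` of degree `m-1` with leading coefficient
`1/(m-1)!`. -/
theorem bmg_quasipolynomial (m g : ℕ) (hm : 1 ≤ m) (hg : 2 ≤ g) :
    ∃ s : ℕ, 0 < s ∧ ∃ p : ℕ → Polynomial ℚ,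
      (∀ i < s, (p i).natDegree = m - 1 ∧
        (p i).leadingCoeff = 1 / (Nat.factorial (m - 1) : ℚ)) ∧
      ∀ t : ℕ, 0 < t → (bmg m g (t : ℤ) : ℚ) = (p (t % s)).eval (t : ℚ) := by
  obtain ⟨k, rfl⟩ := Nat.exists_eq_add_of_le' hm
  obtain ⟨q, ⟨s, hs, p, hp, hqp⟩, hq⟩ := bmg_isQuasipoly (k + 1) g
  obtain ⟨N, hN⟩ := bmg_add_error k g (by omega)
  refine ⟨s, hs, fun i => p i, fun i _ => ?_, fun t ht => ?_⟩
  · have hr : (p i - choosePoly k).degree < k := by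
      refine Polynomial.degree_lt_of_bound _ k N (fun n => i + (n + 1) * s) ?_ fun n => ?_
      · refine Filter.tendsto_atTop_mono (fun n => ?_) Filter.tendsto_id
        simp only [id]
        nlinarith
      · have ht : 0 < i + (n + 1) * s := by positivity
        obtain ⟨e, he, hle⟩ := hN _ ht
        have hpi : p i = p ((i + (n + 1) * s : ℕ) : ℤ) := by
          have := hp.int_mul (n + 1) i
          push_cast at this ⊢
          exact this.symm
        generalize i + (n + 1) * s = t at ht he hle hpi ⊢
        have h1 := hq t (by exact_mod_cast ht)
        rw [hqp] at h1
        rw [hpi, Polynomial.eval_sub, choosePoly_eval _ _ ht, ← he]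
        simp only [Int.cast_natCast] at h1
        rw [← h1, Nat.cast_add, sub_add_cancel_left, abs_neg, Nat.abs_cast]
        exact_mod_cast hle
    have hk : (choosePoly k).degree = k := by
      rw [Polynomial.degree_eq_natDegree, choosePoly_natDegree]
      intro h0
      have := choosePoly_leadingCoeff k
      rw [h0, Polynomial.leadingCoeff_zero] at this
      have hpos : (0 : ℚ) < 1 / (k.factorial : ℚ) := by positivity
      exact hpos.ne this
    rw [← hk] at hr
    simp only
    rw [← sub_add_cancel (p i) (choosePoly k)]
    rw [Nat.add_sub_cancel, Polynomial.natDegree_add_eq_right_of_degree_lt hr,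
      Polynomial.leadingCoeff_add_of_degree_lt hr]
    exact ⟨choosePoly_natDegree k, choosePoly_leadingCoeff k⟩
  · rw [hq t (by exact_mod_cast ht), hqp]
    have h1 := hp.int_mul (t / s : ℕ) (t % s : ℕ)
    have h2 : ((t % s : ℕ) : ℤ) + ((t / s : ℕ) : ℤ) * s = t := by
      exact_mod_cast Nat.mod_add_div' t s
    simp only [Int.cast_natCast] at h1 ⊢
    rw [h2] at h1
    rw [h1]
end
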